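/- arXiv:0911.3940 — 2 statements merged into one kernel-verified Lean document; each statement's English description precedes it below -/
import Mathlib

section
/- Let η : ℝ → ℝ be smooth with η″ > 0, let C ∈ ℝ, and let x : [t₀,T] → ℝ be a Lipschitz continuous function satisfying, for almost every t ∈ [t₀,T], the differential inclusion ẋ(t) ∈ [f(U(x(t)+,t),C), f(U(x(t)−,t),C)], where U is an entropy solution admitting one-sided spatial limits. Then for almost all t ∈ [t₀,T]: if U(x(t)−,t) = U(x(t)+,t) then ẋ(t) = f(U(x(t)+,t),C), while if U(x(t)−,t) > U(x(t)+,t) then ẋ(t) = [A(U(x(t)+,t)) − A(U(x(t)−,t))] / [U(x(t)+,t) − U(x(t)−,t)]. -/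
open MeasureTheory Set Filter Topology

noncomputable section

/-- The Riemann data `φ` with left state `CL` and right state `CR`. -/
def riemann (CL CR : ℝ) (x : ℝ) : ℝ := if x < 0 then CL else CR

/-- The relative entropy `η(v | C) = η(v) - η(C) - η'(C)(v - C)`. -/
def relEnt (η : ℝ → ℝ) (v C : ℝ) : ℝ := η v - η C - deriv η C * (v - C)

/-- The relative entropy flux `F(v, C) = ∫_C^v (η'(w) - η'(C)) A'(w) dw`. -/
def relFlux (A η : ℝ → ℝ) (v C : ℝ) : ℝ := ∫ w in C..v, (deriv η w - deriv η C) * deriv A w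

/-- The normalized relative entropy flux `f(v, C) = F(v, C) / η(v | C)` for `v ≠ C`,
extended by `f(C, C) = A'(C)` on the diagonal. -/
def normFlux (A η : ℝ → ℝ) (v C : ℝ) : ℝ :=
  if v = C then deriv A C else relFlux A η v C / relEnt η v C

/-- `U` is a bounded measurable entropy solution of `∂ₜ U + ∂ₓ A(U) = 0` on `ℝ × (0, ∞)`:
for every entropy/entropy-flux pair `(η, G)` with `η'' ≥ 0` and `G' = η' A'`, and every
nonnegative smooth compactly supported test function `θ` vanishing for `t ≤ 0`, one has
`∫₀^∞ ∫_ℝ (η(U) ∂ₜθ + G(U) ∂ₓθ) dx dt ≥ 0`. -/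
structure IsEntropySol (A : ℝ → ℝ) (U : ℝ → ℝ → ℝ) : Prop where
  bounded : ∃ M, ∀ x t, |U x t| ≤ M
  measurable : Measurable fun p : ℝ × ℝ => U p.1 p.2
  entropy : ∀ η G : ℝ → ℝ, ContDiff ℝ (⊤ : ℕ∞) η → ContDiff ℝ (⊤ : ℕ∞) G →
    (∀ v, 0 ≤ deriv (deriv η) v) → (∀ v, deriv G v = deriv η v * deriv A v) →
    ∀ θ : ℝ → ℝ → ℝ, ContDiff ℝ (⊤ : ℕ∞) (fun p : ℝ × ℝ => θ p.1 p.2) →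
      HasCompactSupport (fun p : ℝ × ℝ => θ p.1 p.2) →
      (∀ x t, 0 ≤ θ x t) → (∀ x t, t ≤ 0 → θ x t = 0) →
      0 ≤ ∫ t in Ioi (0 : ℝ), ∫ x : ℝ,
        (η (U x t) * deriv (fun s => θ x s) t + G (U x t) * deriv (fun y => θ y t) x)

/-- `Um x t = U(x-, t)` and `Up x t = U(x+, t)` are the one-sided spatial limits of `U`,
satisfying `U(x-, t) ≥ U(x+, t)` for all `x` and all `t > 0`. -/
structure HasSideLimits (U Um Up : ℝ → ℝ → ℝ) : Prop where
  left : ∀ x t : ℝ, 0 < t → Tendsto (fun y => U y t) (𝓝[<] x) (𝓝 (Um x t))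
  right : ∀ x t : ℝ, 0 < t → Tendsto (fun y => U y t) (𝓝[>] x) (𝓝 (Up x t))
  mono : ∀ x t : ℝ, 0 < t → Up x t ≤ Um x t

/-- `t ↦ U(·, t)` is continuous from `[0, ∞)` into `L¹_loc(ℝ)`. -/
def L1locCont (U : ℝ → ℝ → ℝ) : Prop :=
  ∀ R > (0 : ℝ), ∀ t₀ ≥ (0 : ℝ),
    Tendsto (fun t => ∫ x in (-R)..R, |U x t - U x t₀|) (𝓝[≥] t₀) (𝓝 0)

/-- `x` is a Filippov solution on the set `s` of the differential inclusion
`ẋ(t) ∈ [f(U(x(t)+, t), C), f(U(x(t)-, t), C)]`, where `f` is the normalized relative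
entropy flux: `x` is Lipschitz on `s` and for a.e. `t ∈ s` it has a derivative lying
in the prescribed interval. -/
def IsFilippov (A η : ℝ → ℝ) (Um Up : ℝ → ℝ → ℝ) (C : ℝ) (s : Set ℝ) (x : ℝ → ℝ) : Prop :=
  (∃ K : NNReal, LipschitzOnWith K x s) ∧
  ∀ᵐ t ∂(volume.restrict s), ∃ d, HasDerivAt x d t ∧
    normFlux A η (Up (x t) t) C ≤ d ∧ d ≤ normFlux A η (Um (x t) t) C

open scoped ContDiff Convolution

/-- A dominated convergence theorem for iterated integrals of uniformly bounded functions
supported in a common box. -/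
theorem tendsto_integral_integral_of_bounded_box {F : ℕ → ℝ → ℝ → ℝ} {G : ℝ → ℝ → ℝ}
    {B S R : ℝ} (s : Set ℝ) (hFm : ∀ n, Measurable fun p : ℝ × ℝ => F n p.1 p.2)
    (hB : ∀ n t y, |F n t y| ≤ B)
    (ht : ∀ n t y, S < |t| → F n t y = 0) (hy : ∀ n t y, R < |y| → F n t y = 0)
    (hlim : ∀ᵐ t ∂volume.restrict s, ∀ᵐ y, Tendsto (fun n => F n t y) atTop (𝓝 (G t y))) :
    Tendsto (fun n => ∫ t in s, ∫ y, F n t y) atTop (𝓝 (∫ t in s, ∫ y, G t y)) := by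
  have hbox : ∀ (a b : ℝ), Integrable ((Icc (-a) a).indicator fun _ => b) (volume : Measure ℝ) :=
    fun a b => (integrable_indicator_iff measurableSet_Icc).2 (integrableOn_const (by simp))
  have hin : ∀ n t y, ‖F n t y‖ ≤ (Icc (-R) R).indicator (fun _ => B) y := by
    intro n t y
    by_cases h : y ∈ Icc (-R) R
    · simpa [h] using hB n t y
    · simp [h, hy n t y (lt_of_not_ge fun h' => h (abs_le.1 h'))]
  refine tendsto_integral_of_dominated_convergence
    ((Icc (-S) S).indicator fun _ => ∫ y, (Icc (-R) R).indicator (fun _ => B) y) ?_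
    (hbox _ _).restrict ?_ ?_
  · exact fun n => ((hFm n).stronglyMeasurable.integral_prod_right').aestronglyMeasurable
  · refine fun n => Eventually.of_forall fun t => ?_
    by_cases h : t ∈ Icc (-S) S
    · rw [indicator_of_mem h]
      exact norm_integral_le_of_norm_le (hbox _ _) (Eventually.of_forall (hin n t))
    · simp [h, ht n t _ (lt_of_not_ge fun h' => h (abs_le.1 h'))]
  · filter_upwards [hlim] with t h
    exact tendsto_integral_of_dominated_convergence _
      (fun n => ((hFm n).comp measurable_prodMk_left).aestronglyMeasurable) (hbox R B)
      (fun n => Eventually.of_forall (hin n t)) h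

/-- A Lipschitz function of one real variable is the limit of smooth functions with the same
Lipschitz bound whose derivatives converge almost everywhere. -/
theorem LipschitzWith.exists_contDiff_approx {X : ℝ → ℝ} {K : NNReal} (hX : LipschitzWith K X) :
    ∃ Y : ℕ → ℝ → ℝ, (∀ n, ContDiff ℝ ∞ (Y n)) ∧ (∀ n, Y n 0 = X 0) ∧
      (∀ n t, |deriv (Y n) t| ≤ K) ∧ (∀ t, Tendsto (fun n => Y n t) atTop (𝓝 (X t))) ∧
      ∀ᵐ t, Tendsto (fun n => deriv (Y n) t) atTop (𝓝 (deriv X t)) := by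
  let φ : ℕ → ContDiffBump (0 : ℝ) := fun n =>
    ⟨1 / ((n : ℝ) + 1), 2 * (1 / ((n : ℝ) + 1)), by positivity, by
      have : 0 < 1 / ((n : ℝ) + 1) := by positivity
      linarith⟩
  have hφ : Tendsto (fun n => (φ n).rOut) atTop (𝓝 0) := by
    simpa [φ] using (tendsto_one_div_add_atTop_nhds_zero_nat (𝕜 := ℝ)).const_mul 2
  have hb : ∀ t, ‖deriv X t‖ ≤ K := fun t => norm_deriv_le_of_lipschitz hX
  have hm : AEStronglyMeasurable (deriv X) volume := (measurable_deriv X).aestronglyMeasurable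
  have hloc : LocallyIntegrable (deriv X) volume :=
    (locallyIntegrable_const (K : ℝ)).mono hm (Eventually.of_forall fun t => by simpa using hb t)
  let g : ℕ → ℝ → ℝ := fun n => (φ n).normed volume ⋆[ContinuousLinearMap.lsmul ℝ ℝ] deriv X
  have hg : ∀ n, ContDiff ℝ ∞ (g n) := fun n =>
    (φ n).hasCompactSupport_normed.contDiff_convolution_left _ (φ n).contDiff_normed hloc
  have hgb : ∀ n t, |g n t| ≤ K := by
    intro n t
    have := dist_convolution_le (μ := volume) (f := (φ n).normed volume) (g := deriv X) (x₀ := t)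
      (R := (φ n).rOut) (z₀ := 0) K.2 (by rw [(φ n).support_normed_eq]) (φ n).nonneg_normed
      (φ n).integral_normed hm (fun x _ => by simpa using hb x)
    simpa [g] using this
  have hga : ∀ᵐ t, Tendsto (fun n => g n t) atTop (𝓝 (deriv X t)) :=
    ContDiffBump.ae_convolution_tendsto_right_of_locallyIntegrable (K := 2) hφ
      (Eventually.of_forall fun n => le_rfl) hloc
  have hd : ∀ n, ∀ t, HasDerivAt (fun t => X 0 + ∫ s in (0 : ℝ)..t, g n s) (g n t) t := fun n t =>
    ((hg n).continuous.integral_hasStrictDerivAt 0 t).hasDerivAt.const_add _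
  have hde : ∀ n, deriv (fun t => X 0 + ∫ s in (0 : ℝ)..t, g n s) = g n :=
    fun n => funext fun t => (hd n t).deriv
  refine ⟨fun n t => X 0 + ∫ s in (0 : ℝ)..t, g n s, fun n => ?_, fun n => by simp,
    fun n t => ?_, fun t => ?_, ?_⟩
  · rw [contDiff_infty_iff_deriv, hde]
    exact ⟨fun t => (hd n t).differentiableAt, hg n⟩
  · rw [hde]; exact hgb n t
  · have hX' := (hX.lipschitzOnWith
      (s := uIcc 0 t)).absolutelyContinuousOnInterval.integral_deriv_eq_sub
    have : X t = X 0 + ∫ s in (0 : ℝ)..t, deriv X s := by rw [hX']; ring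
    rw [this]
    refine tendsto_const_nhds.add ?_
    refine intervalIntegral.tendsto_integral_filter_of_dominated_convergence (fun _ => (K : ℝ))
      (Eventually.of_forall fun n => (hg n).continuous.aestronglyMeasurable)
      (Eventually.of_forall fun n => Eventually.of_forall fun s _ => hgb n s)
      intervalIntegrable_const ?_
    filter_upwards [hga] with s hs _ using hs
  · simpa only [hde] using hga

theorem HasCompactSupport.exists_bound_and_deriv_bound {f : ℝ → ℝ} (hf : HasCompactSupport f)
    (hd : ContDiff ℝ ∞ f) : ∃ S B : ℝ, (∀ t, |f t| ≤ B) ∧ (∀ t, |deriv f t| ≤ B) ∧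
      ∀ t, S < |t| → f t = 0 ∧ deriv f t = 0 := by
  obtain ⟨B₁, h₁⟩ := hf.exists_bound_of_continuous hd.continuous
  obtain ⟨B₂, h₂⟩ := hf.deriv.exists_bound_of_continuous (hd.continuous_deriv (by simp))
  obtain ⟨S, hS⟩ := hf.isCompact.isBounded.subset_closedBall 0
  refine ⟨S, max B₁ B₂, fun t => (h₁ t).trans (le_max_left _ _),
    fun t => (h₂ t).trans (le_max_right _ _), fun t ht => ?_⟩
  have : t ∉ tsupport f := fun h => by
    have := hS h
    rw [mem_closedBall_zero_iff, Real.norm_eq_abs] at this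
    linarith
  exact ⟨image_eq_zero_of_notMem_tsupport this,
    by_contra fun h => this (support_deriv_subset h)⟩

/-- The integrand `U ∂ₜθ + A(U) ∂ₓθ` for the test function `θ(y, t) = ψ(t) ρ(y - X(t))`. -/
def movingIntegrand (A : ℝ → ℝ) (U : ℝ → ℝ → ℝ) (ψ ρ X : ℝ → ℝ) (t y : ℝ) : ℝ :=
  U y t * (deriv ψ t * ρ (y - X t) - ψ t * deriv X t * deriv ρ (y - X t)) +
    A (U y t) * (ψ t * deriv ρ (y - X t))

theorem IsEntropySol.integral_movingIntegrand_of_contDiff {A : ℝ → ℝ} {U : ℝ → ℝ → ℝ}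
    (hA : ContDiff ℝ ∞ A) (hU : IsEntropySol A U) {ψ ρ X : ℝ → ℝ}
    (hψ : ContDiff ℝ ∞ ψ) (hψc : HasCompactSupport ψ) (hψ0 : ∀ t, 0 ≤ ψ t)
    (hψt : ∀ t ≤ 0, ψ t = 0) (hρ : ContDiff ℝ ∞ ρ) (hρc : HasCompactSupport ρ)
    (hρ0 : ∀ z, 0 ≤ ρ z) (hX : ContDiff ℝ ∞ X) :
    ∫ t in Ioi (0 : ℝ), ∫ y, movingIntegrand A U ψ ρ X t y = 0 := by
  have h1 : (∞ : WithTop ℕ∞) ≠ 0 := by simp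
  have hdt : ∀ t y, deriv (fun s => ψ s * ρ (y - X s)) t =
      deriv ψ t * ρ (y - X t) - ψ t * deriv X t * deriv ρ (y - X t) := by
    intro t y
    have hi : HasDerivAt (fun s => y - X s) (-deriv X t) t :=
      (hX.differentiable h1 t).hasDerivAt.const_sub y
    have := ((hψ.differentiable h1 t).hasDerivAt.mul
      ((hρ.differentiable h1 (y - X t)).hasDerivAt.comp t hi)).deriv
    refine this.trans ?_
    simp only [Function.comp]
    ring
  have hdx : ∀ t y, deriv (fun z => ψ t * ρ (z - X t)) y = ψ t * deriv ρ (y - X t) := by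
    intro t y
    have := (((hρ.differentiable h1 (y - X t)).hasDerivAt.comp_sub_const y (X t)).const_mul
      (ψ t)).deriv
    exact this
  have hθ : ContDiff ℝ ∞ fun p : ℝ × ℝ => ψ p.2 * ρ (p.1 - X p.2) :=
    (hψ.comp contDiff_snd).mul (hρ.comp (contDiff_fst.sub (hX.comp contDiff_snd)))
  have hc : HasCompactSupport fun p : ℝ × ℝ => ψ p.2 * ρ (p.1 - X p.2) := by
    refine HasCompactSupport.intro
      ((hρc.isCompact.prod hψc.isCompact).image
        (f := fun q : ℝ × ℝ => (q.1 + X q.2, q.2)) ?_) fun p hp => ?_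
    · have := hX.continuous
      fun_prop
    · by_contra h
      refine hp ⟨(p.1 - X p.2, p.2), ⟨subset_tsupport _ (right_ne_zero_of_mul h),
        subset_tsupport _ (left_ne_zero_of_mul h)⟩, by simp⟩
  have hpos : ∀ x t, 0 ≤ ψ t * ρ (x - X t) := fun x t => mul_nonneg (hψ0 t) (hρ0 _)
  have hzero : ∀ x t, t ≤ 0 → ψ t * ρ (x - X t) = 0 := fun x t ht => by simp [hψt t ht]
  have e1 := hU.entropy (fun v => v) A contDiff_id hA (by simp) (by simp)
    (fun y t => ψ t * ρ (y - X t)) hθ hc hpos hzero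
  have e2 := hU.entropy (fun v => -v) (fun v => -A v) contDiff_id.neg hA.neg (by simp) (by simp)
    (fun y t => ψ t * ρ (y - X t)) hθ hc hpos hzero
  simp only [hdt, hdx] at e1 e2
  refine le_antisymm ?_ e1
  rw [← neg_nonneg, ← integral_neg]
  refine e2.trans_eq (integral_congr_ae (Eventually.of_forall fun t => ?_))
  simp only [← integral_neg]
  refine integral_congr_ae (Eventually.of_forall fun y => ?_)
  simp only [movingIntegrand]
  ring

theorem measurable_movingIntegrand {A : ℝ → ℝ} {U : ℝ → ℝ → ℝ} (hA : Continuous A)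
    (hU : Measurable fun p : ℝ × ℝ => U p.1 p.2) {ψ ρ X : ℝ → ℝ} (hψ : Continuous ψ)
    (hρ : Continuous ρ) (hX : Continuous X) :
    Measurable fun p : ℝ × ℝ => movingIntegrand A U ψ ρ X p.1 p.2 := by
  have hU' : Measurable fun p : ℝ × ℝ => U p.2 p.1 := hU.comp measurable_swap
  have hs : Measurable fun p : ℝ × ℝ => p.2 - X p.1 :=
    measurable_snd.sub (hX.measurable.comp measurable_fst)
  have h1 : ∀ {f : ℝ → ℝ}, Measurable f → Measurable fun p : ℝ × ℝ => f p.1 :=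
    fun h => h.comp measurable_fst
  exact (hU'.mul (((h1 (measurable_deriv ψ)).mul (hρ.measurable.comp hs)).sub
    (((h1 hψ.measurable).mul (h1 (measurable_deriv X))).mul
      ((measurable_deriv ρ).comp hs)))).add
    ((hA.measurable.comp hU').mul ((h1 hψ.measurable).mul ((measurable_deriv ρ).comp hs)))

theorem IsEntropySol.exists_bound {A : ℝ → ℝ} {U : ℝ → ℝ → ℝ} (hA : Continuous A)
    (hU : IsEntropySol A U) : ∃ M, ∀ x t, |U x t| ≤ M ∧ |A (U x t)| ≤ M := by
  obtain ⟨M, hM⟩ := hU.bounded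
  obtain ⟨N, hN⟩ := (isCompact_Icc (a := -M) (b := M)).exists_bound_of_continuousOn
    hA.continuousOn
  exact ⟨max M N, fun x t => ⟨(hM x t).trans (le_max_left _ _),
    (hN _ (abs_le.1 (hM x t))).trans (le_max_right _ _)⟩⟩

theorem IsEntropySol.integral_movingIntegrand_of_lipschitz {A : ℝ → ℝ} {U : ℝ → ℝ → ℝ}
    (hA : ContDiff ℝ ∞ A) (hU : IsEntropySol A U) {ψ ρ X : ℝ → ℝ}
    (hψ : ContDiff ℝ ∞ ψ) (hψc : HasCompactSupport ψ) (hψ0 : ∀ t, 0 ≤ ψ t)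
    (hψt : ∀ t ≤ 0, ψ t = 0) (hρ : ContDiff ℝ ∞ ρ) (hρc : HasCompactSupport ρ)
    (hρ0 : ∀ z, 0 ≤ ρ z) {K : NNReal} (hX : LipschitzWith K X) :
    ∫ t in Ioi (0 : ℝ), ∫ y, movingIntegrand A U ψ ρ X t y = 0 := by
  obtain ⟨Y, hY, hY0, hYK, hYX, hYd⟩ := hX.exists_contDiff_approx
  obtain ⟨S, B, hSB, hSd, hS⟩ := hψc.exists_bound_and_deriv_bound hψ
  obtain ⟨R, D, hRD, hRd, hR⟩ := hρc.exists_bound_and_deriv_bound hρ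
  obtain ⟨M, hM⟩ := hU.exists_bound hA.continuous
  have hM0 : 0 ≤ M := (abs_nonneg _).trans (hM 0 0).1
  have hB0 : 0 ≤ B := (abs_nonneg _).trans (hSB 0)
  have hD0 : 0 ≤ D := (abs_nonneg _).trans (hRD 0)
  have hlim : Tendsto (fun n => ∫ t in Ioi (0 : ℝ), ∫ y, movingIntegrand A U ψ ρ (Y n) t y) atTop
      (𝓝 (∫ t in Ioi (0 : ℝ), ∫ y, movingIntegrand A U ψ ρ X t y)) := by
    refine tendsto_integral_integral_of_bounded_box (B := M * (B * D + B * K * D) + M * (B * D))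
      (S := S) (R := R + (|X 0| + K * S)) _
      (fun n => measurable_movingIntegrand hA.continuous hU.measurable hψ.continuous
        hρ.continuous (hY n).continuous) (fun n t y => ?_) (fun n t y ht => ?_)
      (fun n t y hy => ?_) ?_
    · have a1 : |deriv ψ t * ρ (y - Y n t)| ≤ B * D := by
        rw [abs_mul]; exact mul_le_mul (hSd t) (hRD _) (abs_nonneg _) hB0
      have a2 : |ψ t * deriv (Y n) t * deriv ρ (y - Y n t)| ≤ B * K * D := by
        rw [abs_mul, abs_mul]
        exact mul_le_mul (mul_le_mul (hSB t) (hYK n t) (abs_nonneg _) hB0) (hRd _) (abs_nonneg _)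
          (by positivity)
      have a3 : |ψ t * deriv ρ (y - Y n t)| ≤ B * D := by
        rw [abs_mul]; exact mul_le_mul (hSB t) (hRd _) (abs_nonneg _) hB0
      refine (abs_add_le _ _).trans (add_le_add ?_ ?_)
      · rw [abs_mul]
        exact mul_le_mul (hM _ _).1 ((abs_sub _ _).trans (add_le_add a1 a2)) (abs_nonneg _) hM0
      · rw [abs_mul]
        exact mul_le_mul (hM _ _).2 a3 (abs_nonneg _) hM0
    · simp [movingIntegrand, hS t ht]
    · by_cases ht : S < |t|
      · simp [movingIntegrand, hS t ht]
      · have hL : LipschitzWith K (Y n) := lipschitzWith_of_nnnorm_deriv_le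
          ((hY n).differentiable (by simp)) fun t => by
            simpa [← NNReal.coe_le_coe] using hYK n t
        have h1 : |Y n t - Y n 0| ≤ K * |t| := by
          simpa [Real.dist_eq] using hL.dist_le_mul t 0
        have h2 : (K : ℝ) * |t| ≤ K * S := mul_le_mul_of_nonneg_left (not_lt.1 ht) K.2
        have h3 : |Y n t| ≤ |Y n t - Y n 0| + |X 0| := by
          rw [← hY0 n]
          simpa using abs_add_le (Y n t - Y n 0) (Y n 0)
        have h4 : R < |y - Y n t| := by
          have := abs_sub_abs_le_abs_sub y (Y n t)
          linarith
        simp [movingIntegrand, hR _ h4]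
    · filter_upwards [ae_restrict_of_ae hYd] with t ht
      refine Eventually.of_forall fun y => ?_
      have e : Tendsto (fun n => y - Y n t) atTop (𝓝 (y - X t)) := (hYX t).const_sub y
      have e1 := (hρ.continuous.tendsto (y - X t)).comp e
      have e2 := ((hρ.continuous_deriv (by simp)).tendsto (y - X t)).comp e
      exact (((e1.const_mul (deriv ψ t)).sub ((ht.const_mul (ψ t)).mul e2)).const_mul (U y t)).add
        ((e2.const_mul (ψ t)).const_mul (A (U y t)))
  refine tendsto_nhds_unique hlim ?_
  simp only [hU.integral_movingIntegrand_of_contDiff hA hψ hψc hψ0 hψt hρ hρc hρ0 (hY _)]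
  exact tendsto_const_nhds

/-- The Rankine–Hugoniot defect along a curve of speed `v` with one-sided states `a`, `b`. -/
def rankineHugoniotDefect (A : ℝ → ℝ) (v a b : ℝ) : ℝ := A a - v * a - (A b - v * b)

theorem integral_deriv_mul_ite {φ : ℝ → ℝ} (hφ : ContDiff ℝ ∞ φ) (hφc : HasCompactSupport φ)
    (a b : ℝ) : ∫ z, deriv φ z * (if z < 0 then a else b) = φ 0 * (a - b) := by
  have hi : Integrable (deriv φ) :=
    (hφ.continuous_deriv (by simp)).integrable_of_hasCompactSupport hφc.deriv
  have h1 : ContDiff ℝ 1 φ := hφ.of_le (by simp)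
  have hI : Integrable fun z => deriv φ z * (if z < 0 then a else b) := by
    refine hi.mul_bdd (c := max |a| |b|) (Measurable.ite measurableSet_Iio measurable_const
      measurable_const).aestronglyMeasurable (Eventually.of_forall fun z => ?_)
    split_ifs <;> simp
  rw [← intervalIntegral.integral_Iic_add_Ioi (b := 0) hI.integrableOn hI.integrableOn]
  have e1 : ∫ z in Iic 0, deriv φ z * (if z < 0 then a else b) = φ 0 * a := by
    rw [integral_Iic_eq_integral_Iio, setIntegral_congr_fun (g := fun z => deriv φ z * a)
      measurableSet_Iio fun z hz => by simp [mem_Iio.1 hz], integral_mul_const,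
      ← integral_Iic_eq_integral_Iio, hφc.integral_Iic_deriv_eq h1]
  have e2 : ∫ z in Ioi 0, deriv φ z * (if z < 0 then a else b) = -φ 0 * b := by
    rw [setIntegral_congr_fun (g := fun z => deriv φ z * b)
      measurableSet_Ioi fun z hz => by simp [(mem_Ioi.1 hz).le.not_gt], integral_mul_const,
      hφc.integral_Ioi_deriv_eq h1]
  rw [e1, e2]; ring

theorem IsEntropySol.integral_mul_rankineHugoniotDefect {A : ℝ → ℝ} {U Um Up : ℝ → ℝ → ℝ}
    (hA : ContDiff ℝ ∞ A) (hU : IsEntropySol A U) (hlim : HasSideLimits U Um Up) {ψ X : ℝ → ℝ}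
    (hψ : ContDiff ℝ ∞ ψ) (hψc : HasCompactSupport ψ) (hψ0 : ∀ t, 0 ≤ ψ t)
    (hψt : ∀ t ≤ 0, ψ t = 0) {K : NNReal} (hX : LipschitzWith K X) :
    ∫ t in Ioi (0 : ℝ),
      ψ t * rankineHugoniotDefect A (deriv X t) (Um (X t) t) (Up (X t) t) = 0 := by
  let φ : ContDiffBump (0 : ℝ) := ⟨1, 2, one_pos, one_lt_two⟩
  have hφ : ContDiff ℝ ∞ φ := φ.contDiff
  have hφc : HasCompactSupport φ := φ.hasCompactSupport
  have hφ1 : φ 0 = 1 := φ.one_of_mem_closedBall (by simp [φ])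
  obtain ⟨S, B, hSB, hSd, hS⟩ := hψc.exists_bound_and_deriv_bound hψ
  obtain ⟨R, D, hRD, hRd, hR⟩ := hφc.exists_bound_and_deriv_bound hφ
  obtain ⟨M, hM⟩ := hU.exists_bound hA.continuous
  have hM0 : 0 ≤ M := (abs_nonneg _).trans (hM 0 0).1
  have hB0 : 0 ≤ B := (abs_nonneg _).trans (hSB 0)
  have hD0 : 0 ≤ D := (abs_nonneg _).trans (hRD 0)
  have hXb : ∀ t, |deriv X t| ≤ K := fun t => norm_deriv_le_of_lipschitz hX
  let ε : ℕ → ℝ := fun n => 1 / ((n : ℝ) + 1)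
  have hε : Tendsto ε atTop (𝓝 0) := tendsto_one_div_add_atTop_nhds_zero_nat
  have hε0 : ∀ n, 0 < ε n := fun n => by simp only [ε]; positivity
  have hε1 : ∀ n, ε n ≤ 1 := fun n => by
    simp only [ε]; rw [div_le_one (by positivity)]; linarith [n.cast_nonneg (α := ℝ)]
  let F : ℕ → ℝ → ℝ → ℝ := fun n t z => ε n * (U (X t + ε n * z) t * (deriv ψ t * φ z)) +
    ψ t * (deriv φ z * (A (U (X t + ε n * z) t) - deriv X t * U (X t + ε n * z) t))
  have hscale : ∀ n t, ∫ y, movingIntegrand A U ψ (fun z => φ ((ε n)⁻¹ * z)) X t y =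
      ∫ z, F n t z := by
    intro n t
    have hd : ∀ z, deriv (fun z => φ ((ε n)⁻¹ * z)) z = (ε n)⁻¹ * deriv φ ((ε n)⁻¹ * z) :=
      fun z => by rw [deriv_comp_mul_left, smul_eq_mul]
    have : ∀ y, movingIntegrand A U ψ (fun z => φ ((ε n)⁻¹ * z)) X t y =
        (ε n)⁻¹ * F n t ((ε n)⁻¹ * (y - X t)) := by
      intro y
      have hne := (hε0 n).ne'
      have hy : X t + ε n * ((ε n)⁻¹ * (y - X t)) = y := by field_simp; ring
      simp only [movingIntegrand, F, hd, hy]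
      field_simp
      ring
    simp only [this]
    rw [integral_const_mul, integral_sub_right_eq_self (fun y => F n t ((ε n)⁻¹ * y)),
      Measure.integral_comp_inv_mul_left, abs_of_pos (hε0 n), smul_eq_mul,
      inv_mul_cancel_left₀ (hε0 n).ne']
  have hzero : ∀ n, ∫ t in Ioi (0 : ℝ), ∫ z, F n t z = 0 := by
    intro n
    simp only [← hscale]
    refine hU.integral_movingIntegrand_of_lipschitz hA hψ hψc hψ0 hψt
      (hφ.comp (contDiff_const.mul contDiff_id)) ?_ (fun z => φ.nonneg) hX
    exact hφc.comp_homeomorph (Homeomorph.mulLeft₀ (ε n)⁻¹ (inv_ne_zero (hε0 n).ne'))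
  have hcv : Tendsto (fun n => ∫ t in Ioi (0 : ℝ), ∫ z, F n t z) atTop
      (𝓝 (∫ t in Ioi (0 : ℝ), ∫ z, ψ t * (deriv φ z *
        (if z < 0 then A (Um (X t) t) - deriv X t * Um (X t) t
          else A (Up (X t) t) - deriv X t * Up (X t) t)))) := by
    refine tendsto_integral_integral_of_bounded_box
      (B := 1 * (M * (B * D)) + B * (D * (M + K * M))) (S := S) (R := R) _ (fun n => ?_)
      (fun n t z => ?_) (fun n t z ht => ?_) (fun n t z hz => ?_) ?_
    · have hm : Measurable fun p : ℝ × ℝ => U (X p.1 + ε n * p.2) p.1 :=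
        hU.measurable.comp (((hX.continuous.measurable.comp measurable_fst).add
          (measurable_snd.const_mul _)).prodMk measurable_fst)
      have h1 : ∀ {f : ℝ → ℝ}, Measurable f → Measurable fun p : ℝ × ℝ => f p.1 :=
        fun h => h.comp measurable_fst
      have h2 : ∀ {f : ℝ → ℝ}, Measurable f → Measurable fun p : ℝ × ℝ => f p.2 :=
        fun h => h.comp measurable_snd
      exact ((hm.mul ((h1 (measurable_deriv ψ)).mul (h2 hφ.continuous.measurable))).const_mul
        _).add ((h1 hψ.continuous.measurable).mul ((h2 (measurable_deriv φ)).mul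
          ((hA.continuous.measurable.comp hm).sub ((h1 (measurable_deriv X)).mul hm))))
    · have a1 : |U (X t + ε n * z) t * (deriv ψ t * φ z)| ≤ M * (B * D) := by
        rw [abs_mul, abs_mul]
        exact mul_le_mul (hM _ _).1 (mul_le_mul (hSd t) (hRD z) (abs_nonneg _) hB0)
          (by positivity) hM0
      have a2 : |A (U (X t + ε n * z) t) - deriv X t * U (X t + ε n * z) t| ≤ M + K * M := by
        refine (abs_sub _ _).trans (add_le_add (hM _ _).2 ?_)
        rw [abs_mul]
        exact mul_le_mul (hXb t) (hM _ _).1 (abs_nonneg _) K.2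
      refine (abs_add_le _ _).trans (add_le_add ?_ ?_)
      · rw [abs_mul, abs_of_pos (hε0 n)]
        exact mul_le_mul (hε1 n) a1 (abs_nonneg _) zero_le_one
      · rw [abs_mul, abs_mul]
        exact mul_le_mul (hSB t) (mul_le_mul (hRd z) a2 (abs_nonneg _) hD0) (by positivity) hB0
    · simp [F, hS t ht]
    · simp [F, hR z hz]
    · filter_upwards [ae_restrict_mem measurableSet_Ioi] with t ht
      filter_upwards [Measure.ae_ne volume (0 : ℝ)] with z hz
      have e0 : Tendsto (fun n => ε n * (U (X t + ε n * z) t * (deriv ψ t * φ z))) atTop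
          (𝓝 0) := by
        refine squeeze_zero_norm (a := fun n => ε n * (M * (B * D))) (fun n => ?_)
          (by simpa using hε.mul_const (M * (B * D)))
        rw [Real.norm_eq_abs, abs_mul, abs_mul, abs_mul, abs_of_pos (hε0 n)]
        exact mul_le_mul_of_nonneg_left (mul_le_mul (hM _ _).1
          (mul_le_mul (hSd t) (hRD z) (abs_nonneg _) hB0) (by positivity) hM0) (hε0 n).le
      have ex : Tendsto (fun n => X t + ε n * z) atTop (𝓝 (X t)) := by
        simpa using (hε.mul_const z).const_add (X t)
      have key : ∀ u, Tendsto (fun n => U (X t + ε n * z) t) atTop (𝓝 u) →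
          Tendsto (fun n => F n t z) atTop (𝓝 (ψ t * (deriv φ z * (A u - deriv X t * u)))) := by
        intro u hu
        simpa using e0.add (((((hA.continuous.tendsto u).comp hu).sub
          (hu.const_mul (deriv X t))).const_mul (deriv φ z)).const_mul (ψ t))
      rcases lt_or_gt_of_ne hz with hz | hz
      · rw [if_pos hz]
        refine key _ ((hlim.left (X t) t ht).comp (tendsto_nhdsWithin_iff.2
          ⟨ex, Eventually.of_forall fun n => ?_⟩))
        simpa using mul_neg_of_pos_of_neg (hε0 n) hz
      · rw [if_neg hz.not_gt]
        refine key _ ((hlim.right (X t) t ht).comp (tendsto_nhdsWithin_iff.2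
          ⟨ex, Eventually.of_forall fun n => ?_⟩))
        simpa using mul_pos (hε0 n) hz
  simp only [hzero] at hcv
  refine Eq.trans ?_ (tendsto_nhds_unique tendsto_const_nhds hcv).symm
  simp only [integral_const_mul, integral_deriv_mul_ite hφ hφc, hφ1, one_mul,
    rankineHugoniotDefect]

/-- The Rankine–Hugoniot relation holds at almost every time along a Lipschitz curve. -/
theorem IsEntropySol.ae_rankineHugoniotDefect_eq_zero {A : ℝ → ℝ} {U Um Up : ℝ → ℝ → ℝ}
    (hA : ContDiff ℝ ∞ A) (hU : IsEntropySol A U) (hlim : HasSideLimits U Um Up) {X : ℝ → ℝ}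
    {K : NNReal} (hX : LipschitzWith K X) {t₀ T : ℝ} (ht₀ : 0 ≤ t₀) (hT : t₀ < T) :
    ∀ᵐ t, t ∈ Ioo t₀ T →
      rankineHugoniotDefect A (deriv X t) (Um (X t) t) (Up (X t) t) = 0 := by
  let χ : ContDiffBump ((t₀ + T) / 2) :=
    ⟨(T - t₀) / 4, (T - t₀) / 2, by linarith, by linarith⟩
  have hball : Metric.ball ((t₀ + T) / 2) χ.rOut = Ioo t₀ T := by
    rw [Real.ball_eq_Ioo]
    congr 1 <;> simp only [χ] <;> ring
  have hχs : ∀ t, t ∉ Ioo t₀ T → χ t = 0 := fun t ht => by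
    rw [← hball, ← χ.support_eq] at ht
    exact Function.notMem_support.1 ht
  have hχt : ∀ t ≤ 0, χ t = 0 := fun t ht => hχs t fun h => by linarith [h.1]
  let J : ℝ → ℝ := fun t =>
    χ t * rankineHugoniotDefect A (deriv X t) (Um (X t) t) (Up (X t) t)
  obtain ⟨M, hM⟩ := hU.exists_bound hA.continuous
  have hM0 : 0 ≤ M := (abs_nonneg _).trans (hM 0 0).1
  have hXb : ∀ t, |deriv X t| ≤ K := fun t => norm_deriv_le_of_lipschitz hX
  let ε : ℕ → ℝ := fun n => 1 / ((n : ℝ) + 1)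
  have hε : Tendsto ε atTop (𝓝 0) := tendsto_one_div_add_atTop_nhds_zero_nat
  have hε0 : ∀ n, 0 < ε n := fun n => by simp only [ε]; positivity
  let H : ℕ → ℝ → ℝ := fun n t => χ t *
    rankineHugoniotDefect A (deriv X t) (U (X t - ε n) t) (U (X t + ε n) t)
  have hH : ∀ t, Tendsto (fun n => H n t) atTop (𝓝 (J t)) := by
    intro t
    rcases le_or_gt t 0 with ht | ht
    · simp [H, J, hχt t ht]
    · have eL : Tendsto (fun n => U (X t - ε n) t) atTop (𝓝 (Um (X t) t)) :=
        (hlim.left (X t) t ht).comp (tendsto_nhdsWithin_iff.2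
          ⟨by simpa using hε.const_sub (X t), Eventually.of_forall fun n => by
            simpa using hε0 n⟩)
      have eR : Tendsto (fun n => U (X t + ε n) t) atTop (𝓝 (Up (X t) t)) :=
        (hlim.right (X t) t ht).comp (tendsto_nhdsWithin_iff.2
          ⟨by simpa using hε.const_add (X t), Eventually.of_forall fun n => by
            simpa using hε0 n⟩)
      exact ((((hA.continuous.tendsto _).comp eL).sub (eL.const_mul _)).sub
        (((hA.continuous.tendsto _).comp eR).sub (eR.const_mul _))).const_mul _
  have hHm : ∀ n, Measurable (H n) := by
    intro n
    have hX' := hX.continuous.measurable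
    have mL : Measurable fun t => U (X t - ε n) t :=
      hU.measurable.comp ((hX'.sub_const _).prodMk measurable_id)
    have mR : Measurable fun t => U (X t + ε n) t :=
      hU.measurable.comp ((hX'.add_const _).prodMk measurable_id)
    have hd := measurable_deriv X
    have hA' := hA.continuous.measurable
    exact χ.continuous.measurable.mul (((hA'.comp mL).sub (hd.mul mL)).sub
      ((hA'.comp mR).sub (hd.mul mR)))
  have hJm : Measurable J := measurable_of_tendsto_metrizable hHm (tendsto_pi_nhds.2 hH)
  have hHb : ∀ n t, |H n t| ≤ χ t * (M + K * M + (M + K * M)) := by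
    intro n t
    have a : ∀ y, |A (U y t) - deriv X t * U y t| ≤ M + K * M := by
      intro y
      refine (abs_sub _ _).trans (add_le_add (hM _ _).2 ?_)
      rw [abs_mul]
      exact mul_le_mul (hXb t) (hM _ _).1 (abs_nonneg _) K.2
    rw [abs_mul, abs_of_nonneg χ.nonneg]
    exact mul_le_mul_of_nonneg_left ((abs_sub _ _).trans (add_le_add (a _) (a _))) χ.nonneg
  have hJi : Integrable J :=
    ((χ.continuous.integrable_of_hasCompactSupport χ.hasCompactSupport).mul_const _).mono'
      hJm.aestronglyMeasurable (Eventually.of_forall fun t =>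
        le_of_tendsto (hH t).abs (Eventually.of_forall fun n => hHb n t))
  have hpos : ∀ g : ℝ → ℝ, ContDiff ℝ ∞ g → (∀ t, 0 ≤ g t) → ∫ t, g t * J t = 0 := by
    intro g hg hg0
    have := hU.integral_mul_rankineHugoniotDefect hA hlim (ψ := fun t => g t * χ t)
      (hg.mul χ.contDiff) χ.hasCompactSupport.mul_left (fun t => mul_nonneg (hg0 t) χ.nonneg)
      (fun t ht => by simp [hχt t ht]) hX
    rw [setIntegral_eq_integral_of_forall_compl_eq_zero
      fun t ht => by simp [hχt t (not_lt.1 ht)]] at this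
    simpa only [J, mul_assoc] using this
  have hJ0 : ∀ᵐ t, J t = 0 := by
    refine ae_eq_zero_of_integral_contDiff_smul_eq_zero hJi.locallyIntegrable fun g hg hgc => ?_
    obtain ⟨c, hc⟩ := hgc.exists_bound_of_continuous hg.continuous
    have h1 := hpos (fun t => g t + c) (hg.add contDiff_const) fun t => by
      linarith [(abs_le.1 (hc t)).1]
    have h2 := hpos (fun _ => c) contDiff_const fun t => (norm_nonneg _).trans (hc t)
    have hi : Integrable fun t => g t * J t :=
      hJi.bdd_mul hg.continuous.aestronglyMeasurable (Eventually.of_forall hc)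
    simp only [add_mul] at h1
    rw [integral_add hi (hJi.const_mul c), h2, add_zero] at h1
    exact h1
  filter_upwards [hJ0] with t ht hm
  refine (mul_eq_zero.1 ht).resolve_left ?_
  rw [← hball] at hm
  exact (χ.pos_of_mem_ball hm).ne'

/-- **Proposition 3.2.** If `x` is a Filippov solution of
`ẋ(t) ∈ [f(U(x(t)+, t), C), f(U(x(t)-, t), C)]`, then for a.e. `t`: at points of continuity
of `U`, `ẋ(t) = f(U(x(t)±, t), C)`, while at discontinuities `ẋ(t)` is the Rankine–Hugoniot
shock speed. -/
theorem filippov_velocity_dichotomy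
    (A : ℝ → ℝ) (hA : ContDiff ℝ (⊤ : ℕ∞) A) (hA'' : ∀ x, 0 < deriv (deriv A) x)
    (U Um Up : ℝ → ℝ → ℝ)
    (hsol : IsEntropySol A U) (hlim : HasSideLimits U Um Up) (hcont : L1locCont U)
    (η : ℝ → ℝ) (hη : ContDiff ℝ (⊤ : ℕ∞) η) (hconv : ∀ v, 0 < deriv (deriv η) v)
    (C t₀ T : ℝ) (ht₀ : 0 ≤ t₀) (hT : t₀ < T)
    (x dx : ℝ → ℝ) (K : NNReal) (hx : LipschitzOnWith K x (Icc t₀ T))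
    (hdx : ∀ᵐ t ∂(volume.restrict (Icc t₀ T)), HasDerivAt x (dx t) t ∧
      normFlux A η (Up (x t) t) C ≤ dx t ∧ dx t ≤ normFlux A η (Um (x t) t) C) :
    ∀ᵐ t ∂(volume.restrict (Icc t₀ T)),
      (Um (x t) t = Up (x t) t → dx t = normFlux A η (Up (x t) t) C) ∧
      (Up (x t) t < Um (x t) t →
        dx t = (A (Up (x t) t) - A (Um (x t) t)) / (Up (x t) t - Um (x t) t)) := by
  obtain ⟨X, hX, hXx⟩ := hx.extend_real
  have hRH := hsol.ae_rankineHugoniotDefect_eq_zero hA hlim hX ht₀ hT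
  rw [← restrict_Ioo_eq_restrict_Icc] at hdx ⊢
  filter_upwards [hdx, ae_restrict_of_ae hRH, ae_restrict_mem measurableSet_Ioo]
    with t ⟨hd, h₁, h₂⟩ hR ht
  refine ⟨fun h => le_antisymm (h ▸ h₂) h₁, fun h => ?_⟩
  have hev : X =ᶠ[𝓝 t] x := by
    filter_upwards [Ioo_mem_nhds ht.1 ht.2] with s hs using (hXx (Ioo_subset_Icc_self hs)).symm
  have hR' := hR ht
  rw [hev.deriv_eq, hd.deriv, hev.eq_of_nhds] at hR'
  rw [eq_div_iff (sub_ne_zero.2 h.ne)]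
  simp only [rankineHugoniotDefect] at hR'
  linarith
end
end

section
/- Let C_L > C_R, let U be a bounded entropy solution admitting one-sided spatial limits, let η be smooth with η″ > 0, and assume x_L, x_R : [t₀,T] → ℝ are Filippov solutions of ẋ_L(t) ∈ [f(U(x_L(t)+,t),C_L), f(U(x_L(t)−,t),C_L)] and ẋ_R(t) ∈ [f(U(x_R(t)+,t),C_R), f(U(x_R(t)−,t),C_R)], with x_R(t) − x_L(t) ≥ δ for a fixed δ > 0 and all t ∈ [t₀,T]. Then for each C ∈ (C_R, C_L) there exists λ > 0, independent of δ, such that for all a, b with t₀ ≤ a < b ≤ T: ∫_{x_L(b)}^{x_R(b)} η(U(x,b)|C) dx − ∫_{x_L(a)}^{x_R(a)} η(U(x,a)|C) dx ≤ −λ·|S_{a,b}| ≤ 0, where S_{a,b} := {s ∈ [a,b] : ẋ_R(s) − ẋ_L(s) ≥ 0} and |S_{a,b}| is its Lebesgue measure. -/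
open MeasureTheory Set Filter Topology

noncomputable section

section RelativeEntropy

variable {A η : ℝ → ℝ}

/-- A continuous function whose derivative is positive away from one point is strictly monotone. -/
theorem strictMono_of_hasDerivAt_pos_of_ne {g g' : ℝ → ℝ} {c : ℝ} (hg : Continuous g)
    (hd : ∀ x, x ≠ c → HasDerivAt g (g' x) x) (hpos : ∀ x, x ≠ c → 0 < g' x) : StrictMono g := by
  have h1 : StrictMonoOn g (Iic c) := by
    refine strictMonoOn_of_deriv_pos (convex_Iic c) hg.continuousOn fun x hx => ?_
    rw [interior_Iic] at hx
    rw [(hd x hx.ne).deriv]; exact hpos x hx.ne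
  have h2 : StrictMonoOn g (Ici c) := by
    refine strictMonoOn_of_deriv_pos (convex_Ici c) hg.continuousOn fun x hx => ?_
    rw [interior_Ici] at hx
    rw [(hd x hx.ne').deriv]; exact hpos x hx.ne'
  exact h1.Iic_union_Ici h2

theorem ContDiff.hasDerivAt_smooth {g : ℝ → ℝ} (hg : ContDiff ℝ (⊤ : ℕ∞) g) (x : ℝ) :
    HasDerivAt g (deriv g x) x :=
  (hg.differentiable (by simp) x).hasDerivAt

theorem ContDiff.deriv_smooth {g : ℝ → ℝ} (hg : ContDiff ℝ (⊤ : ℕ∞) g) :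
    ContDiff ℝ (⊤ : ℕ∞) (deriv g) :=
  (contDiff_infty_iff_deriv.mp hg).2

@[simp] theorem relEnt_self (C : ℝ) : relEnt η C C = 0 := by simp [relEnt]

@[simp] theorem relFlux_self (C : ℝ) : relFlux A η C C = 0 := by simp [relFlux]

theorem hasDerivAt_relEnt (hη : ContDiff ℝ (⊤ : ℕ∞) η) (v C : ℝ) :
    HasDerivAt (fun v => relEnt η v C) (deriv η v - deriv η C) v := by
  have := ((hη.hasDerivAt_smooth v).sub_const (η C)).sub
    (((hasDerivAt_id v).sub_const C).const_mul (deriv η C))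
  exact this.congr_deriv (by simp)

theorem continuous_relFlux_integrand (hA : ContDiff ℝ (⊤ : ℕ∞) A) (hη : ContDiff ℝ (⊤ : ℕ∞) η)
    (c : ℝ) : Continuous fun w => (deriv η w - c) * deriv A w :=
  ((hη.deriv_smooth.continuous).sub continuous_const).mul hA.deriv_smooth.continuous

theorem hasDerivAt_relFlux (hA : ContDiff ℝ (⊤ : ℕ∞) A) (hη : ContDiff ℝ (⊤ : ℕ∞) η) (v C : ℝ) :
    HasDerivAt (fun v => relFlux A η v C) ((deriv η v - deriv η C) * deriv A v) v :=
  (continuous_relFlux_integrand hA hη _).integral_hasStrictDerivAt C v |>.hasDerivAt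

theorem contDiff_relEnt (hη : ContDiff ℝ (⊤ : ℕ∞) η) (C : ℝ) :
    ContDiff ℝ (⊤ : ℕ∞) (fun v => relEnt η v C) := by
  unfold relEnt
  fun_prop

theorem contDiff_relFlux (hA : ContDiff ℝ (⊤ : ℕ∞) A) (hη : ContDiff ℝ (⊤ : ℕ∞) η) (C : ℝ) :
    ContDiff ℝ (⊤ : ℕ∞) (fun v => relFlux A η v C) := by
  rw [contDiff_infty_iff_deriv]
  refine ⟨fun v => (hasDerivAt_relFlux hA hη v C).differentiableAt, ?_⟩
  rw [funext fun v => (hasDerivAt_relFlux hA hη v C).deriv]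
  exact (hη.deriv_smooth.sub contDiff_const).mul hA.deriv_smooth

theorem hasDerivAt_relEnt_right (hη : ContDiff ℝ (⊤ : ℕ∞) η) (u C : ℝ) :
    HasDerivAt (fun C => relEnt η u C) (deriv (deriv η) C * (C - u)) C := by
  have := ((hη.hasDerivAt_smooth C).const_sub (η u)).sub
    ((hη.deriv_smooth.hasDerivAt_smooth C).mul ((hasDerivAt_id C).const_sub u))
  refine this.congr_deriv ?_
  simp
  ring

theorem relFlux_eq (hA : ContDiff ℝ (⊤ : ℕ∞) A) (hη : ContDiff ℝ (⊤ : ℕ∞) η) (u C : ℝ) :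
    relFlux A η u C = (∫ w in C..u, deriv η w * deriv A w) - deriv η C * (A u - A C) := by
  have h1 : ∫ w in C..u, deriv A w = A u - A C :=
    intervalIntegral.integral_deriv_eq_sub (fun x _ => hA.differentiable (by simp) x)
      (hA.deriv_smooth.continuous.intervalIntegrable _ _)
  have hc := hA.deriv_smooth.continuous
  have hc' := hη.deriv_smooth.continuous
  rw [← h1, ← intervalIntegral.integral_const_mul, ← intervalIntegral.integral_sub]
  · simp [relFlux, sub_mul]
  · exact (hc'.mul hc).intervalIntegrable _ _
  · exact (continuous_const.mul hc).intervalIntegrable _ _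

theorem hasDerivAt_relFlux_right (hA : ContDiff ℝ (⊤ : ℕ∞) A) (hη : ContDiff ℝ (⊤ : ℕ∞) η)
    (u C : ℝ) :
    HasDerivAt (fun C => relFlux A η u C) (deriv (deriv η) C * (A C - A u)) C := by
  rw [funext fun C => relFlux_eq hA hη u C]
  have hc := hA.deriv_smooth.continuous
  have hc' := hη.deriv_smooth.continuous
  have h1 : HasDerivAt (fun C => ∫ w in C..u, deriv η w * deriv A w)
      (-(deriv η C * deriv A C)) C :=
    intervalIntegral.integral_hasDerivAt_left ((hc'.mul hc).intervalIntegrable _ _)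
      ((hc'.mul hc).stronglyMeasurableAtFilter _ _) (hc'.mul hc).continuousAt
  refine (h1.sub ((hη.deriv_smooth.hasDerivAt_smooth C).mul
    ((hA.hasDerivAt_smooth C).const_sub (A u)))).congr_deriv ?_
  ring

theorem relEnt_pos (hη : ContDiff ℝ (⊤ : ℕ∞) η) (hconv : ∀ v, 0 < deriv (deriv η) v)
    {v C : ℝ} (h : v ≠ C) : 0 < relEnt η v C := by
  have hm := strictMono_of_deriv_pos hconv
  have hc : Continuous fun v => relEnt η v C := (contDiff_relEnt hη C).continuous
  rw [← relEnt_self (η := η) C]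
  rcases h.lt_or_gt with h | h
  · refine strictAntiOn_of_deriv_neg (convex_Iic C) hc.continuousOn (fun x hx => ?_)
      (mem_Iic.2 h.le) self_mem_Iic h
    rw [interior_Iic] at hx
    rw [(hasDerivAt_relEnt hη x C).deriv, sub_neg]; exact hm hx
  · refine strictMonoOn_of_deriv_pos (convex_Ici C) hc.continuousOn (fun x hx => ?_)
      self_mem_Ici (mem_Ici.2 h.le) h
    rw [interior_Ici] at hx
    rw [(hasDerivAt_relEnt hη x C).deriv, sub_pos]; exact hm hx

theorem relEnt_nonneg (hη : ContDiff ℝ (⊤ : ℕ∞) η) (hconv : ∀ v, 0 < deriv (deriv η) v)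
    (v C : ℝ) : 0 ≤ relEnt η v C := by
  rcases eq_or_ne v C with rfl | h
  · simp
  · exact (relEnt_pos hη hconv h).le

theorem strictMono_relFlux_sub (hA : ContDiff ℝ (⊤ : ℕ∞) A) (hA2 : ∀ x, 0 < deriv (deriv A) x)
    (hη : ContDiff ℝ (⊤ : ℕ∞) η) (hconv : ∀ v, 0 < deriv (deriv η) v) (C : ℝ) :
    StrictMono fun v => relFlux A η v C - deriv A C * relEnt η v C := by
  refine strictMono_of_hasDerivAt_pos_of_ne (c := C)
    (g' := fun v => (deriv η v - deriv η C) * deriv A v - deriv A C * (deriv η v - deriv η C))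
    ((contDiff_relFlux hA hη C).continuous.sub
      (continuous_const.mul (contDiff_relEnt hη C).continuous))
    (fun x _ => (hasDerivAt_relFlux hA hη x C).sub ((hasDerivAt_relEnt hη x C).const_mul _))
    fun x hx => ?_
  have e : (deriv η x - deriv η C) * deriv A x - deriv A C * (deriv η x - deriv η C)
    = (deriv η x - deriv η C) * (deriv A x - deriv A C) := by ring
  simp only [e]
  rcases hx.lt_or_gt with h | h
  · exact mul_pos_of_neg_of_neg (sub_neg.2 (strictMono_of_deriv_pos hconv h))
      (sub_neg.2 (strictMono_of_deriv_pos hA2 h))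
  · exact mul_pos (sub_pos.2 (strictMono_of_deriv_pos hconv h))
      (sub_pos.2 (strictMono_of_deriv_pos hA2 h))

theorem monotone_mul_relEnt_sub_relFlux (hA : ContDiff ℝ (⊤ : ℕ∞) A)
    (hA2 : ∀ x, 0 < deriv (deriv A) x)
    (hη : ContDiff ℝ (⊤ : ℕ∞) η) (hconv : ∀ v, 0 < deriv (deriv η) v) (C : ℝ) :
    Monotone fun v => deriv A v * relEnt η v C - relFlux A η v C := by
  have hd : ∀ v, HasDerivAt (fun v => deriv A v * relEnt η v C - relFlux A η v C)
      (deriv (deriv A) v * relEnt η v C) v := fun v => by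
    refine (((hA.deriv_smooth.hasDerivAt_smooth v).mul (hasDerivAt_relEnt hη v C)).sub
      (hasDerivAt_relFlux hA hη v C)).congr_deriv ?_
    ring
  refine monotone_of_deriv_nonneg (fun v => (hd v).differentiableAt) fun v => ?_
  rw [(hd v).deriv]
  exact mul_nonneg (hA2 v).le (relEnt_nonneg hη hconv v C)

theorem abs_normFlux_sub_le (hA : ContDiff ℝ (⊤ : ℕ∞) A) (hA2 : ∀ x, 0 < deriv (deriv A) x)
    (hη : ContDiff ℝ (⊤ : ℕ∞) η) (hconv : ∀ v, 0 < deriv (deriv η) v) (u C : ℝ) :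
    |normFlux A η u C - deriv A C| ≤ |deriv A u - deriv A C| := by
  unfold normFlux
  split_ifs with h
  · simp [h]
  have hp := relEnt_pos hη hconv h
  have e : relFlux A η u C / relEnt η u C - deriv A C
      = (relFlux A η u C - deriv A C * relEnt η u C) / relEnt η u C := by field_simp
  have h1 := (strictMono_relFlux_sub hA hA2 hη hconv C).monotone
  have h2 := monotone_mul_relEnt_sub_relFlux hA hA2 hη hconv C
  rw [e, abs_div, abs_of_pos hp, div_le_iff₀ hp]
  rcases (Ne.lt_or_gt h) with h | h
  · have h1 := h1 h.le
    have h2 := h2 h.le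
    have h3 := strictMono_of_deriv_pos hA2 h
    simp only [relEnt_self, relFlux_self] at h1 h2
    rw [abs_of_nonpos (by linarith), abs_of_neg (by linarith)]
    linarith
  · have h1 := h1 h.le
    have h2 := h2 h.le
    have h3 := strictMono_of_deriv_pos hA2 h
    simp only [relEnt_self, relFlux_self] at h1 h2
    rw [abs_of_nonneg (by linarith), abs_of_pos (by linarith)]
    linarith

theorem normFlux_mul_relEnt (hη : ContDiff ℝ (⊤ : ℕ∞) η) (hconv : ∀ v, 0 < deriv (deriv η) v)
    (u C : ℝ) : normFlux A η u C * relEnt η u C = relFlux A η u C := by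
  unfold normFlux
  split_ifs with h
  · simp [h]
  · have := (relEnt_pos hη hconv h).ne'
    field_simp

theorem continuous_normFlux_left (hA : ContDiff ℝ (⊤ : ℕ∞) A) (hA2 : ∀ x, 0 < deriv (deriv A) x)
    (hη : ContDiff ℝ (⊤ : ℕ∞) η) (hconv : ∀ v, 0 < deriv (deriv η) v) (C : ℝ) :
    Continuous fun u => normFlux A η u C := by
  rw [continuous_iff_continuousAt]
  intro u
  rcases eq_or_ne u C with rfl | h
  · have h0 : normFlux A η u u = deriv A u := by simp [normFlux]
    rw [ContinuousAt, h0, tendsto_iff_norm_sub_tendsto_zero]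
    refine squeeze_zero (fun _ => norm_nonneg _)
      (fun v => abs_normFlux_sub_le hA hA2 hη hconv v u) ?_
    simpa using ((hA.deriv_smooth.continuous.tendsto u).sub_const (deriv A u)).abs
  · have : ContinuousAt (fun u => relFlux A η u C / relEnt η u C) u :=
      (contDiff_relFlux hA hη C).continuous.continuousAt.div
        (contDiff_relEnt hη C).continuous.continuousAt (relEnt_pos hη hconv h).ne'
    refine this.congr ?_
    filter_upwards [isOpen_ne.mem_nhds h] with v hv
    simp [normFlux, show v ≠ C from hv]

theorem normFlux_secant_pos (hA : ContDiff ℝ (⊤ : ℕ∞) A) (hA2 : ∀ x, 0 < deriv (deriv A) x)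
    (hη : ContDiff ℝ (⊤ : ℕ∞) η) (hconv : ∀ v, 0 < deriv (deriv η) v) {u C : ℝ} (h : C ≠ u) :
    0 < (A C - A u) * relEnt η u C - relFlux A η u C * (C - u) := by
  have hd : ∀ C, HasDerivAt (fun C => (A C - A u) * relEnt η u C - relFlux A η u C * (C - u))
      (deriv A C * relEnt η u C - relFlux A η u C) C := fun C => by
    refine ((((hA.hasDerivAt_smooth C).sub_const (A u)).mul
      (hasDerivAt_relEnt_right hη u C)).sub ((hasDerivAt_relFlux_right hA hη u C).mul
      ((hasDerivAt_id C).sub_const u))).congr_deriv ?_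
    simp
    ring
  have hc : Continuous fun C => (A C - A u) * relEnt η u C - relFlux A η u C * (C - u) :=
    continuous_iff_continuousAt.2 fun C => (hd C).continuousAt
  have h0 : (A u - A u) * relEnt η u u - relFlux A η u u * (u - u) = 0 := by simp
  rw [← h0]
  rcases h.lt_or_gt with h | h
  · refine strictAntiOn_of_deriv_neg (convex_Iic u) hc.continuousOn (fun x hx => ?_)
      (mem_Iic.2 h.le) self_mem_Iic h
    rw [interior_Iic] at hx
    rw [(hd x).deriv]
    have := strictMono_relFlux_sub hA hA2 hη hconv x hx
    simp at this
    linarith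
  · refine strictMonoOn_of_deriv_pos (convex_Ici u) hc.continuousOn (fun x hx => ?_)
      self_mem_Ici (mem_Ici.2 h.le) h
    rw [interior_Ici] at hx
    rw [(hd x).deriv]
    have := strictMono_relFlux_sub hA hA2 hη hconv x hx
    simp at this
    linarith

/-- The normalized relative entropy flux is strictly increasing in its second argument. -/
theorem strictMono_normFlux_right (hA : ContDiff ℝ (⊤ : ℕ∞) A)
    (hA2 : ∀ x, 0 < deriv (deriv A) x)
    (hη : ContDiff ℝ (⊤ : ℕ∞) η) (hconv : ∀ v, 0 < deriv (deriv η) v) (u : ℝ) :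
    StrictMono fun C => normFlux A η u C := by
  have hd : ∀ C, C ≠ u → HasDerivAt (fun C => normFlux A η u C)
      (deriv (deriv η) C * ((A C - A u) * relEnt η u C - relFlux A η u C * (C - u))
        / relEnt η u C ^ 2) C := fun C h => by
    have hp := relEnt_pos hη hconv h.symm
    have h1 := ((hasDerivAt_relFlux_right hA hη u C).div (hasDerivAt_relEnt_right hη u C) hp.ne')
    refine (h1.congr_deriv ?_).congr_of_eventuallyEq ?_
    · congr 1; ring
    · filter_upwards [isOpen_ne.mem_nhds h] with v hv
      simp [normFlux, Ne.symm (show v ≠ u from hv)]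
  refine strictMono_of_hasDerivAt_pos_of_ne (c := u) ?_ hd fun C h =>
    div_pos (mul_pos (hconv C) (normFlux_secant_pos hA hA2 hη hconv h))
      (pow_pos (relEnt_pos hη hconv h.symm) 2)
  rw [continuous_iff_continuousAt]
  intro C
  rcases eq_or_ne C u with rfl | h
  · have h0 : normFlux A η C C = deriv A C := by simp [normFlux]
    have hcA := hA.deriv_smooth.continuous.tendsto C
    have h1 : Tendsto (fun D => normFlux A η C D - deriv A D) (𝓝 C) (𝓝 0) := by
      rw [tendsto_zero_iff_norm_tendsto_zero]
      refine squeeze_zero (fun _ => norm_nonneg _)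
        (fun v => abs_normFlux_sub_le hA hA2 hη hconv C v) ?_
      simpa using (hcA.const_sub (deriv A C)).abs
    rw [ContinuousAt, h0]
    simpa using h1.add hcA
  · exact (hd C h).continuousAt

/-- The dissipation through the two curves, bounded below uniformly over bounded traces for which
the speed of the left curve does not exceed that of the right one. -/
theorem exists_dissipation_lower_bound (hA : ContDiff ℝ (⊤ : ℕ∞) A)
    (hA2 : ∀ x, 0 < deriv (deriv A) x) (hη : ContDiff ℝ (⊤ : ℕ∞) η)
    (hconv : ∀ v, 0 < deriv (deriv η) v) {C CL CR : ℝ} (hC : C ∈ Ioo CR CL) (M : ℝ) :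
    ∃ lam : ℝ, 0 < lam ∧ ∀ u v σ τ : ℝ, |u| ≤ M → |v| ≤ M →
      normFlux A η u CL ≤ σ → τ ≤ normFlux A η v CR →
      (relFlux A η u C - σ * relEnt η u C) - (relFlux A η v C - τ * relEnt η v C) ≤ 0 ∧
      (σ ≤ τ → (relFlux A η u C - σ * relEnt η u C) - (relFlux A η v C - τ * relEnt η v C)
        ≤ -lam) := by
  let D : ℝ × ℝ → ℝ := fun p =>
    (normFlux A η p.1 CL * relEnt η p.1 C - relFlux A η p.1 C) +
      (relFlux A η p.2 C - normFlux A η p.2 CR * relEnt η p.2 C)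
  have hcL := continuous_normFlux_left hA hA2 hη hconv CL
  have hcR := continuous_normFlux_left hA hA2 hη hconv CR
  have hcE := (contDiff_relEnt hη C).continuous
  have hcF := (contDiff_relFlux hA hη C).continuous
  have hDc : Continuous D := by
    have := hcL.comp continuous_fst (X := ℝ × ℝ)
    have := hcR.comp continuous_snd (X := ℝ × ℝ)
    have := hcE.comp continuous_fst (X := ℝ × ℝ)
    have := hcE.comp continuous_snd (X := ℝ × ℝ)
    have := hcF.comp continuous_fst (X := ℝ × ℝ)
    have := hcF.comp continuous_snd (X := ℝ × ℝ)
    simp only [Function.comp_def] at *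
    fun_prop
  let K : Set (ℝ × ℝ) := (Icc (-M) M ×ˢ Icc (-M) M) ∩
    {p | normFlux A η p.1 CL ≤ normFlux A η p.2 CR}
  have hK : IsCompact K := (isCompact_Icc.prod isCompact_Icc).inter_right
    (isClosed_le (hcL.comp continuous_fst) (hcR.comp continuous_snd))
  have hm := strictMono_normFlux_right hA hA2 hη hconv
  have hl0 : ∀ u, 0 ≤ normFlux A η u CL * relEnt η u C - relFlux A η u C := fun u => by
    rw [← normFlux_mul_relEnt hη hconv u C, ← sub_mul]
    exact mul_nonneg (sub_nonneg.2 (hm u hC.2).le) (relEnt_nonneg hη hconv u C)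
  have hr0 : ∀ u, 0 ≤ relFlux A η u C - normFlux A η u CR * relEnt η u C := fun u => by
    rw [← normFlux_mul_relEnt hη hconv u C, ← sub_mul]
    exact mul_nonneg (sub_nonneg.2 (hm u hC.1).le) (relEnt_nonneg hη hconv u C)
  have hpos : ∀ p ∈ K, 0 < D p := by
    rintro ⟨u, v⟩ ⟨-, hp⟩
    rcases eq_or_ne u C with rfl | hu
    · have hv : v ≠ u := by
        rintro rfl
        exact absurd hp.out (not_le.2 (hm v (hC.1.trans hC.2)))
      refine add_pos_of_nonneg_of_pos (hl0 u) ?_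
      simp only
      rw [← normFlux_mul_relEnt hη hconv v u, ← sub_mul]
      exact mul_pos (sub_pos.2 (hm v hC.1)) (relEnt_pos hη hconv hv)
    · refine add_pos_of_pos_of_nonneg ?_ (hr0 v)
      simp only
      rw [← normFlux_mul_relEnt hη hconv u C, ← sub_mul]
      exact mul_pos (sub_pos.2 (hm u hC.2)) (relEnt_pos hη hconv hu)
  have hlam : ∃ lam : ℝ, 0 < lam ∧ ∀ p ∈ K, lam ≤ D p := by
    rcases K.eq_empty_or_nonempty with h | h
    · exact ⟨1, one_pos, by simp [h]⟩
    · obtain ⟨p, hp, hmin⟩ := hK.exists_isMinOn h hDc.continuousOn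
      exact ⟨D p, hpos p hp, fun q hq => hmin hq⟩
  obtain ⟨lam, hlam, hD⟩ := hlam
  refine ⟨lam, hlam, fun u v σ τ hu hv hσ hτ => ?_⟩
  have e1 := mul_le_mul_of_nonneg_right hσ (relEnt_nonneg hη hconv u C)
  have e2 := mul_le_mul_of_nonneg_right hτ (relEnt_nonneg hη hconv v C)
  have hle : (relFlux A η u C - σ * relEnt η u C) - (relFlux A η v C - τ * relEnt η v C)
      ≤ -D (u, v) := by
    simp only [D]; linarith
  refine ⟨?_, fun h => ?_⟩
  · have := hl0 u
    have := hr0 v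
    simp only [D] at hle
    linarith
  · have := hD (u, v) ⟨⟨abs_le.1 hu, abs_le.1 hv⟩, (hσ.trans h).trans hτ⟩
    linarith

end RelativeEntropy

section WeakBalance

theorem deriv_smoothTransition_eq_zero {y : ℝ} (hy : y ∉ Icc (0 : ℝ) 1) :
    deriv Real.smoothTransition y = 0 := by
  rw [mem_Icc, not_and_or, not_le, not_le] at hy
  rcases hy with hy | hy
  · have : Real.smoothTransition =ᶠ[𝓝 y] fun _ => 0 := by
      filter_upwards [Iio_mem_nhds hy] with z hz
      exact Real.smoothTransition.zero_of_nonpos hz.out.le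
    rw [this.deriv_eq, deriv_const]
  · have : Real.smoothTransition =ᶠ[𝓝 y] fun _ => 1 := by
      filter_upwards [Ioi_mem_nhds hy] with z hz
      exact Real.smoothTransition.one_of_one_le hz.out.le
    rw [this.deriv_eq, deriv_const]

theorem deriv_smoothTransition_of_nonpos {y : ℝ} (hy : y ≤ 0) :
    deriv Real.smoothTransition y = 0 := by
  rcases hy.lt_or_eq with h | rfl
  · exact deriv_smoothTransition_eq_zero fun h' => absurd h'.1 (not_le.2 h)
  · have : IsLocalMin Real.smoothTransition 0 := by
      refine Eventually.of_forall fun y => ?_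
      rw [Real.smoothTransition.zero]
      exact Real.smoothTransition.nonneg y
    exact this.deriv_eq_zero

theorem contDiff_smoothTransition : ContDiff ℝ (⊤ : ℕ∞) Real.smoothTransition :=
  Real.smoothTransition.contDiff

theorem continuous_deriv_smoothTransition : Continuous (deriv Real.smoothTransition) :=
  contDiff_smoothTransition.deriv_smooth.continuous

theorem hasCompactSupport_deriv_smoothTransition :
    HasCompactSupport (deriv Real.smoothTransition) :=
  HasCompactSupport.intro isCompact_Icc fun _ hy => deriv_smoothTransition_eq_zero hy

theorem integrable_deriv_smoothTransition : Integrable (deriv Real.smoothTransition) :=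
  continuous_deriv_smoothTransition.integrable_of_hasCompactSupport
    hasCompactSupport_deriv_smoothTransition

theorem integral_deriv_smoothTransition : ∫ y, deriv Real.smoothTransition y = 1 := by
  have h := integral_of_hasDerivAt_of_tendsto (f := Real.smoothTransition) (m := 0) (n := 1)
    (fun x => contDiff_smoothTransition.hasDerivAt_smooth x) integrable_deriv_smoothTransition
    (tendsto_const_nhds.congr' ?_) (tendsto_const_nhds.congr' ?_)
  · simpa using h
  · filter_upwards [eventually_le_atBot 0] with z hz
    exact (Real.smoothTransition.zero_of_nonpos hz).symm
  · filter_upwards [eventually_ge_atTop 1] with z hz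
    exact (Real.smoothTransition.one_of_one_le hz).symm

theorem exists_bound_deriv_smoothTransition :
    ∃ S : ℝ, 0 ≤ S ∧ ∀ y, |deriv Real.smoothTransition y| ≤ S := by
  obtain ⟨S, hS⟩ := hasCompactSupport_deriv_smoothTransition.exists_bound_of_continuous
    continuous_deriv_smoothTransition
  exact ⟨S, (norm_nonneg _).trans (hS 0), hS⟩

/-- Rescaled derivatives of the smooth transition form an approximate identity from the right. -/
theorem tendsto_integral_deriv_smoothTransition {h : ℝ → ℝ} (hm : Measurable h) {B : ℝ}
    (hB : ∀ t, |h t| ≤ B) {a : ℝ} (hc : Tendsto h (𝓝[≥] a) (𝓝 (h a))) :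
    Tendsto (fun m : ℕ => ∫ t, ((m : ℝ) + 1) * deriv Real.smoothTransition (((m : ℝ) + 1) * (t - a))
      * h t) atTop (𝓝 (h a)) := by
  have hscale : ∀ m : ℕ, ∫ t, ((m : ℝ) + 1) *
      deriv Real.smoothTransition (((m : ℝ) + 1) * (t - a)) * h t
      = ∫ y, deriv Real.smoothTransition y * h (a + y / ((m : ℝ) + 1)) := fun m => by
    have hp : (0 : ℝ) < (m : ℝ) + 1 := by positivity
    set G : ℝ → ℝ := fun y => deriv Real.smoothTransition y * h (a + y / ((m : ℝ) + 1)) with hG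
    have e : ∀ t, ((m : ℝ) + 1) * deriv Real.smoothTransition (((m : ℝ) + 1) * (t - a)) * h t
        = ((m : ℝ) + 1) * G (((m : ℝ) + 1) * (t - a)) := fun t => by
      simp only [hG]
      rw [show a + ((m : ℝ) + 1) * (t - a) / ((m : ℝ) + 1) = t by field_simp; ring]
      ring
    simp_rw [e]
    rw [integral_const_mul, integral_sub_right_eq_self (fun t => G (((m : ℝ) + 1) * t)) a,
      Measure.integral_comp_mul_left, abs_of_pos (inv_pos.2 hp), smul_eq_mul,
      mul_inv_cancel_left₀ hp.ne']
  simp_rw [hscale]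
  have hlim : (∫ y, deriv Real.smoothTransition y * h a) = h a := by
    rw [integral_mul_const, integral_deriv_smoothTransition, one_mul]
  rw [← hlim]
  refine tendsto_integral_of_dominated_convergence
    (fun y => |deriv Real.smoothTransition y| * B) (fun m => ?_)
    (integrable_deriv_smoothTransition.abs.mul_const B) (fun m => ?_) ?_
  · exact (continuous_deriv_smoothTransition.measurable.mul
      (hm.comp (by fun_prop))).aestronglyMeasurable
  · refine Eventually.of_forall fun y => ?_
    rw [norm_mul]
    exact mul_le_mul_of_nonneg_left (hB _) (norm_nonneg _)
  · refine Eventually.of_forall fun y => ?_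
    by_cases hy : y ∈ Icc (0 : ℝ) 1
    · refine Tendsto.const_mul _ (hc.comp ?_)
      refine tendsto_nhdsWithin_iff.2 ⟨?_, Eventually.of_forall fun m => ?_⟩
      · have := (tendsto_one_div_add_atTop_nhds_zero_nat (𝕜 := ℝ)).const_mul y |>.const_add a
        simpa [div_eq_mul_inv] using this
      · have : 0 ≤ y / ((m : ℝ) + 1) := div_nonneg hy.1 (by positivity)
        simpa using this
    · simp [deriv_smoothTransition_eq_zero hy]

section Partial

variable {Φ : ℝ → ℝ → ℝ}

theorem hasDerivAt_fst_of_contDiff (hΦ : ContDiff ℝ (⊤ : ℕ∞) fun p : ℝ × ℝ => Φ p.1 p.2)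
    (x t : ℝ) : HasDerivAt (fun y => Φ y t)
      (fderiv ℝ (fun p : ℝ × ℝ => Φ p.1 p.2) (x, t) (1, 0)) x := by
  have h := (hΦ.differentiable (by simp) (x, t)).hasFDerivAt
  exact h.comp_hasDerivAt (f := fun y => (y, t)) x ((hasDerivAt_id x).prodMk (hasDerivAt_const x t))

theorem hasDerivAt_snd_of_contDiff (hΦ : ContDiff ℝ (⊤ : ℕ∞) fun p : ℝ × ℝ => Φ p.1 p.2)
    (x t : ℝ) : HasDerivAt (fun s => Φ x s)
      (fderiv ℝ (fun p : ℝ × ℝ => Φ p.1 p.2) (x, t) (0, 1)) t := by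
  have h := (hΦ.differentiable (by simp) (x, t)).hasFDerivAt
  exact h.comp_hasDerivAt (f := fun s => (x, s)) t ((hasDerivAt_const t x).prodMk (hasDerivAt_id t))

theorem continuous_deriv_fst (hΦ : ContDiff ℝ (⊤ : ℕ∞) fun p : ℝ × ℝ => Φ p.1 p.2) :
    Continuous fun p : ℝ × ℝ => deriv (fun y => Φ y p.2) p.1 := by
  have e : (fun p : ℝ × ℝ => deriv (fun y => Φ y p.2) p.1) =
      fun p => fderiv ℝ (fun p : ℝ × ℝ => Φ p.1 p.2) p (1, 0) :=
    funext fun p => (hasDerivAt_fst_of_contDiff hΦ p.1 p.2).deriv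
  rw [e]
  exact (hΦ.continuous_fderiv (by simp)).clm_apply continuous_const

theorem continuous_deriv_snd (hΦ : ContDiff ℝ (⊤ : ℕ∞) fun p : ℝ × ℝ => Φ p.1 p.2) :
    Continuous fun p : ℝ × ℝ => deriv (fun s => Φ p.1 s) p.2 := by
  have e : (fun p : ℝ × ℝ => deriv (fun s => Φ p.1 s) p.2) =
      fun p => fderiv ℝ (fun p : ℝ × ℝ => Φ p.1 p.2) p (0, 1) :=
    funext fun p => (hasDerivAt_snd_of_contDiff hΦ p.1 p.2).deriv
  rw [e]
  exact (hΦ.continuous_fderiv (by simp)).clm_apply continuous_const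

end Partial

/-- A bounded measurable function is integrable on a set of finite measure. -/
theorem integrable_restrict_of_bound {g : ℝ → ℝ} (hg : Measurable g) {B : ℝ}
    (hB : ∀ x, |g x| ≤ B) (N : ℝ) : Integrable g (volume.restrict (Icc (-N) N)) :=
  Integrable.of_bound hg.aestronglyMeasurable B (Eventually.of_forall hB)

theorem abs_setIntegral_le_of_bound {g : ℝ → ℝ} {B N : ℝ} (hN : 0 ≤ N) (hB : ∀ x, |g x| ≤ B) :
    |∫ x in Icc (-N) N, g x| ≤ B * (2 * N) := by
  have h := norm_setIntegral_le_of_norm_le_const (μ := volume) (s := Icc (-N) N) (f := g) (C := B)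
    (by simp) (fun x _ => hB x)
  rw [Real.volume_real_Icc_of_le (by linarith)] at h
  calc _ ≤ _ := h
    _ = _ := by ring

theorem exists_bound_comp {g : ℝ → ℝ} (hg : Continuous g) (M : ℝ) :
    ∃ B : ℝ, 0 ≤ B ∧ ∀ v, |v| ≤ M → |g v| ≤ B := by
  obtain ⟨B, hB⟩ := (isCompact_Icc (a := -M) (b := M)).exists_bound_of_continuousOn hg.continuousOn
  exact ⟨max B 0, le_max_right _ _, fun v hv => (hB v (abs_le.1 hv)).trans (le_max_left _ _)⟩

variable {A : ℝ → ℝ} {U : ℝ → ℝ → ℝ}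

theorem tendsto_integral_mul_of_L1locCont (hm : Measurable fun p : ℝ × ℝ => U p.1 p.2) {M : ℝ}
    (hM : ∀ x t, |U x t| ≤ M) (hcont : L1locCont U) {e : ℝ → ℝ} (he : ContDiff ℝ (⊤ : ℕ∞) e)
    {Φ : ℝ → ℝ → ℝ} (hΦ : Continuous fun p : ℝ × ℝ => Φ p.1 p.2) {B : ℝ}
    (hB : ∀ x t, |Φ x t| ≤ B) {N : ℝ} (hN : 0 < N) {t₀ : ℝ} (ht₀ : 0 ≤ t₀) :
    Tendsto (fun t => ∫ x in Icc (-N) N, e (U x t) * Φ x t) (𝓝[≥] t₀)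
      (𝓝 (∫ x in Icc (-N) N, e (U x t₀) * Φ x t₀)) := by
  have hB0 : 0 ≤ B := (abs_nonneg _).trans (hB 0 0)
  obtain ⟨Be, -, hBe⟩ := exists_bound_comp he.continuous M
  obtain ⟨L, hL0, hL⟩ := exists_bound_comp he.deriv_smooth.continuous M
  have hlip : ∀ u v, |u| ≤ M → |v| ≤ M → |e u - e v| ≤ L * |u - v| := fun u v hu hv =>
    Convex.norm_image_sub_le_of_norm_deriv_le (s := Icc (-M) M) (f := e)
      (fun x _ => he.differentiable (by simp) x) (fun x hx => hL x (abs_le.2 hx)) (convex_Icc _ _)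
      (abs_le.1 hv) (abs_le.1 hu)
  have hUt : ∀ t, Measurable fun x => U x t := fun t =>
    hm.comp (measurable_id.prodMk measurable_const)
  have hEt : ∀ t, Measurable fun x => e (U x t) := fun t => he.continuous.measurable.comp (hUt t)
  have hΦt : ∀ t, Measurable fun x => Φ x t := fun t =>
    (hΦ.comp (continuous_id.prodMk continuous_const)).measurable
  have hbd : ∀ s t x, |e (U x s) * Φ x t| ≤ Be * B := fun s t x => by
    rw [abs_mul]
    exact mul_le_mul (hBe _ (hM _ _)) (hB _ _) (abs_nonneg _) ((abs_nonneg _).trans (hBe _ (hM x s)))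
  have h1 : Tendsto (fun t => ∫ x in Icc (-N) N, e (U x t₀) * Φ x t) (𝓝[≥] t₀)
      (𝓝 (∫ x in Icc (-N) N, e (U x t₀) * Φ x t₀)) := by
    refine tendsto_integral_filter_of_dominated_convergence (fun _ => Be * B)
      (Eventually.of_forall fun t => ((hEt t₀).mul (hΦt t)).aestronglyMeasurable)
      (Eventually.of_forall fun t => Eventually.of_forall (hbd t₀ t)) (integrable_const _)
      (Eventually.of_forall fun x => ?_)
    exact (((hΦ.comp (continuous_const.prodMk continuous_id)).tendsto t₀).mono_left
      nhdsWithin_le_nhds).const_mul _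
  have h2 : Tendsto (fun t => ∫ x in Icc (-N) N, (e (U x t) - e (U x t₀)) * Φ x t) (𝓝[≥] t₀)
      (𝓝 0) := by
    rw [tendsto_zero_iff_norm_tendsto_zero]
    have h3 : Tendsto (fun t => (L * B) * ∫ x in (-N)..N, |U x t - U x t₀|) (𝓝[≥] t₀) (𝓝 0) := by
      simpa using (hcont N hN t₀ ht₀).const_mul (L * B)
    refine squeeze_zero (fun _ => norm_nonneg _) (fun t => ?_) h3
    rw [intervalIntegral.integral_of_le (by linarith), ← integral_Icc_eq_integral_Ioc,
      ← integral_const_mul]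
    refine norm_integral_le_of_norm_le ?_ (Eventually.of_forall fun x => ?_)
    · refine (integrable_restrict_of_bound ((hUt t).sub (hUt t₀)).abs (B := M + M)
        (fun x => ?_) N).const_mul _
      rw [abs_abs]
      exact (abs_sub _ _).trans (add_le_add (hM _ _) (hM _ _))
    · rw [norm_mul]
      calc _ ≤ (L * |U x t - U x t₀|) * B :=
            mul_le_mul (hlip _ _ (hM _ _) (hM _ _)) (hB _ _) (abs_nonneg _) (by positivity)
        _ = _ := by ring
  have h4 := h2.add h1
  rw [zero_add] at h4
  refine h4.congr fun t => ?_
  rw [← integral_add]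
  · congr 1; ext x; ring
  · simp_rw [sub_mul]
    exact (integrable_restrict_of_bound ((hEt t).mul (hΦt t)) (hbd t t) N).sub
      (integrable_restrict_of_bound ((hEt t₀).mul (hΦt t)) (hbd t₀ t) N)
  · exact integrable_restrict_of_bound ((hEt t₀).mul (hΦt t)) (hbd t₀ t) N

/-- The difference of two rescaled smooth transitions is a smooth cutoff in time. -/
theorem cutoff_eq_zero {a b c t : ℝ} (hab : a < b) (hc : 1 ≤ c) (ht : t ∉ Icc a (b + 1)) :
    Real.smoothTransition (c * (t - a)) - Real.smoothTransition (c * (t - b)) = 0 := by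
  rw [mem_Icc, not_and_or, not_le, not_le] at ht
  rcases ht with ht | ht
  · rw [Real.smoothTransition.zero_of_nonpos, Real.smoothTransition.zero_of_nonpos, sub_zero] <;>
    nlinarith
  · rw [Real.smoothTransition.one_of_one_le, Real.smoothTransition.one_of_one_le, sub_self] <;>
    nlinarith

theorem hasDerivAt_cutoff (a b c t : ℝ) :
    HasDerivAt (fun t => Real.smoothTransition (c * (t - a)) - Real.smoothTransition (c * (t - b)))
      (c * deriv Real.smoothTransition (c * (t - a)) -
        c * deriv Real.smoothTransition (c * (t - b))) t := by
  have h : ∀ d, HasDerivAt (fun t => Real.smoothTransition (c * (t - d)))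
      (c * deriv Real.smoothTransition (c * (t - d))) t := fun d => by
    have h1 := (contDiff_smoothTransition.hasDerivAt_smooth (c * (t - d))).comp t
      (((hasDerivAt_id t).sub_const d).const_mul c)
    exact h1.congr_deriv (by simp [mul_comm])
  exact (h a).sub (h b)

theorem tendsto_smoothTransition_scaled (t a : ℝ) :
    Tendsto (fun m : ℕ => Real.smoothTransition (((m : ℝ) + 1) * (t - a))) atTop
      (𝓝 (if a < t then 1 else 0)) := by
  split_ifs with h
  · have h1 : Tendsto (fun m : ℕ => ((m : ℝ) + 1) * (t - a)) atTop atTop :=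
      (tendsto_natCast_atTop_atTop.atTop_add tendsto_const_nhds).atTop_mul_const (sub_pos.2 h)
    refine tendsto_const_nhds.congr' ?_
    filter_upwards [h1.eventually_ge_atTop 1] with m hm
    exact (Real.smoothTransition.one_of_one_le hm).symm
  · refine tendsto_const_nhds.congr fun m => ?_
    refine (Real.smoothTransition.zero_of_nonpos ?_).symm
    exact mul_nonpos_of_nonneg_of_nonpos (by positivity) (by linarith)

/-- The entropy inequality integrated between two times, against a weight that is smooth,
nonnegative and spatially supported in `[-N, N]`. -/
theorem IsEntropySol.entropy_balance (hsol : IsEntropySol A U) (hcont : L1locCont U)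
    {e q : ℝ → ℝ} (he : ContDiff ℝ (⊤ : ℕ∞) e) (hq : ContDiff ℝ (⊤ : ℕ∞) q)
    (he2 : ∀ v, 0 ≤ deriv (deriv e) v) (heq : ∀ v, deriv q v = deriv e v * deriv A v)
    {Φ : ℝ → ℝ → ℝ} (hΦ : ContDiff ℝ (⊤ : ℕ∞) fun p : ℝ × ℝ => Φ p.1 p.2)
    (hΦ0 : ∀ x t, 0 ≤ Φ x t) {B : ℝ} (hB : ∀ x t, |Φ x t| ≤ B)
    (hBt : ∀ x t, |deriv (fun s => Φ x s) t| ≤ B) (hBx : ∀ x t, |deriv (fun y => Φ y t) x| ≤ B)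
    {N a b : ℝ} (hN : 0 < N) (ha : 0 ≤ a) (hab : a < b)
    (hsupp : ∀ t ∈ Icc a (b + 1), ∀ x, x ∉ Icc (-N) N → Φ x t = 0) :
    (∫ x in Icc (-N) N, e (U x b) * Φ x b) - (∫ x in Icc (-N) N, e (U x a) * Φ x a) ≤
      ∫ t in Icc a b, ∫ x in Icc (-N) N,
        (e (U x t) * deriv (fun s => Φ x s) t + q (U x t) * deriv (fun y => Φ y t) x) := by
  obtain ⟨M, hM⟩ := hsol.bounded
  have hm := hsol.measurable
  obtain ⟨Be, hBe0, hBe⟩ := exists_bound_comp he.continuous M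
  obtain ⟨Bq, hBq0, hBq⟩ := exists_bound_comp hq.continuous M
  have hB0 : 0 ≤ B := (abs_nonneg _).trans (hB 0 0)
  have hcΦt := continuous_deriv_snd hΦ
  have hcΦx := continuous_deriv_fst hΦ
  have hEm : Measurable fun p : ℝ × ℝ => e (U p.1 p.2) := he.continuous.measurable.comp hm
  have hQm : Measurable fun p : ℝ × ℝ => q (U p.1 p.2) := hq.continuous.measurable.comp hm
  set H : ℝ → ℝ := fun t => ∫ x in Icc (-N) N, e (U x t) * Φ x t with hH
  set r : ℝ → ℝ → ℝ := fun x t =>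
    e (U x t) * deriv (fun s => Φ x s) t + q (U x t) * deriv (fun y => Φ y t) x with hr
  set R : ℝ → ℝ := fun t => ∫ x in Icc (-N) N, r x t with hR
  have hrm : Measurable fun p : ℝ × ℝ => r p.1 p.2 :=
    (hEm.mul hcΦt.measurable).add (hQm.mul hcΦx.measurable)
  have hhm : Measurable fun p : ℝ × ℝ => e (U p.1 p.2) * Φ p.1 p.2 :=
    hEm.mul hΦ.continuous.measurable
  have hslice : ∀ {g : ℝ → ℝ → ℝ}, (Measurable fun p : ℝ × ℝ => g p.1 p.2) → ∀ t,
      Measurable fun x => g x t := fun hg t => hg.comp (measurable_id.prodMk measurable_const)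
  have hbh : ∀ x t, |e (U x t) * Φ x t| ≤ Be * B := fun x t => by
    rw [abs_mul]; exact mul_le_mul (hBe _ (hM _ _)) (hB _ _) (abs_nonneg _) hBe0
  have hbr : ∀ x t, |r x t| ≤ Be * B + Bq * B := fun x t => by
    refine (abs_add_le _ _).trans (add_le_add ?_ ?_)
    · rw [abs_mul]; exact mul_le_mul (hBe _ (hM _ _)) (hBt _ _) (abs_nonneg _) hBe0
    · rw [abs_mul]; exact mul_le_mul (hBq _ (hM _ _)) (hBx _ _) (abs_nonneg _) hBq0
  have hHm : Measurable H :=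
    ((hhm.comp measurable_swap).stronglyMeasurable.integral_prod_right
      (ν := volume.restrict (Icc (-N) N)) (f := fun t x => e (U x t) * Φ x t)).measurable
  have hRm : Measurable R :=
    ((hrm.comp measurable_swap).stronglyMeasurable.integral_prod_right
      (ν := volume.restrict (Icc (-N) N)) (f := fun t x => r x t)).measurable
  have hHb : ∀ t, |H t| ≤ Be * B * (2 * N) := fun t =>
    abs_setIntegral_le_of_bound hN.le fun x => hbh x t
  have hRb : ∀ t, |R t| ≤ (Be * B + Bq * B) * (2 * N) := fun t =>
    abs_setIntegral_le_of_bound hN.le fun x => hbr x t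
  have hHa : Tendsto H (𝓝[≥] a) (𝓝 (H a)) :=
    tendsto_integral_mul_of_L1locCont hm hM hcont he hΦ.continuous hB hN ha
  have hHc : Tendsto H (𝓝[≥] b) (𝓝 (H b)) :=
    tendsto_integral_mul_of_L1locCont hm hM hcont he hΦ.continuous hB hN (ha.trans hab.le)
  let χ : ℕ → ℝ → ℝ := fun m t => Real.smoothTransition (((m : ℝ) + 1) * (t - a)) -
    Real.smoothTransition (((m : ℝ) + 1) * (t - b))
  let κ : ℕ → ℝ → ℝ → ℝ := fun m d t =>
    ((m : ℝ) + 1) * deriv Real.smoothTransition (((m : ℝ) + 1) * (t - d))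
  have hc1 : ∀ m : ℕ, (1 : ℝ) ≤ (m : ℝ) + 1 := fun m => by simp
  have hχd : ∀ m t, HasDerivAt (χ m) (κ m a t - κ m b t) t := fun m t =>
    hasDerivAt_cutoff a b _ t
  have hχ0 : ∀ m t, t ∉ Icc a (b + 1) → χ m t = 0 := fun m t ht => cutoff_eq_zero hab (hc1 m) ht
  have hχs : ∀ m, ContDiff ℝ (⊤ : ℕ∞) (χ m) := fun m =>
    (contDiff_smoothTransition.comp (contDiff_const.mul (contDiff_id.sub contDiff_const))).sub
      (contDiff_smoothTransition.comp (contDiff_const.mul (contDiff_id.sub contDiff_const)))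
  have hχb : ∀ m t, |χ m t| ≤ 1 := fun m t => by
    have h1 := Real.smoothTransition.nonneg (((m : ℝ) + 1) * (t - a))
    have h2 := Real.smoothTransition.nonneg (((m : ℝ) + 1) * (t - b))
    have h3 := Real.smoothTransition.le_one (((m : ℝ) + 1) * (t - a))
    have h4 := Real.smoothTransition.le_one (((m : ℝ) + 1) * (t - b))
    exact abs_le.2 ⟨by simp only [χ]; linarith, by simp only [χ]; linarith⟩
  have hκ0 : ∀ m d t, t ≤ d → κ m d t = 0 := fun m d t ht => by
    simp [κ, deriv_smoothTransition_of_nonpos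
      (mul_nonpos_of_nonneg_of_nonpos (by positivity : (0 : ℝ) ≤ (m : ℝ) + 1) (sub_nonpos.2 ht))]
  have hκi : ∀ m d, Integrable (κ m d) := fun m d => by
    have h1 := integrable_deriv_smoothTransition.comp_mul_left' (R := (m : ℝ) + 1) (by positivity)
    exact (h1.comp_sub_right d).const_mul _
  have hκH : ∀ m d, Integrable fun t => κ m d t * H t := fun m d =>
    (hκi m d).mul_bdd hHm.aestronglyMeasurable (Eventually.of_forall hHb)
  have hχR : ∀ m, Integrable fun t => χ m t * R t := fun m => by
    refine Integrable.mul_bdd ?_ hRm.aestronglyMeasurable (Eventually.of_forall hRb)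
    exact (hχs m).continuous.integrable_of_hasCompactSupport
      (HasCompactSupport.intro isCompact_Icc (hχ0 m))
  have hineq : ∀ m, 0 ≤ (∫ t, κ m a t * H t) - (∫ t, κ m b t * H t) + ∫ t, χ m t * R t := by
    intro m
    let θ : ℝ → ℝ → ℝ := fun x t => χ m t * Φ x t
    have hθ0 : ∀ x t, x ∉ Icc (-N) N → θ x t = 0 := fun x t hx => by
      by_cases ht : t ∈ Icc a (b + 1)
      · simp [θ, hsupp t ht x hx]
      · simp [θ, hχ0 m t ht]
    have hθt : ∀ x t, HasDerivAt (fun s => θ x s)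
        ((κ m a t - κ m b t) * Φ x t + χ m t * deriv (fun s => Φ x s) t) t := fun x t =>
      (hχd m t).mul (hasDerivAt_snd_of_contDiff hΦ x t).differentiableAt.hasDerivAt
    have hθx : ∀ x t, HasDerivAt (fun y => θ y t) (χ m t * deriv (fun y => Φ y t) x) x :=
      fun x t => (hasDerivAt_fst_of_contDiff hΦ x t).differentiableAt.hasDerivAt.const_mul _
    have h := hsol.entropy e q he hq he2 heq θ
      (((hχs m).comp contDiff_snd).mul hΦ)
      (HasCompactSupport.intro ((isCompact_Icc (a := -N) (b := N)).prod
        (isCompact_Icc (a := a) (b := b + 1))) fun p hp => by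
          rw [mem_prod, not_and_or] at hp
          rcases hp with hp | hp
          · exact hθ0 _ _ hp
          · simp [θ, hχ0 m _ hp])
      (fun x t => mul_nonneg (sub_nonneg.2 (Real.smoothTransition.monotone
        (mul_le_mul_of_nonneg_left (by linarith) (by positivity)))) (hΦ0 x t))
      (fun x t ht => by
        have h1 : ((m : ℝ) + 1) * (t - a) ≤ 0 :=
          mul_nonpos_of_nonneg_of_nonpos (by positivity) (by linarith)
        have h2 : ((m : ℝ) + 1) * (t - b) ≤ 0 :=
          mul_nonpos_of_nonneg_of_nonpos (by positivity) (by linarith)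
        simp [θ, χ, Real.smoothTransition.zero_of_nonpos h1,
          Real.smoothTransition.zero_of_nonpos h2])
    have hinner : ∀ t, (∫ x : ℝ, (e (U x t) * deriv (fun s => θ x s) t +
        q (U x t) * deriv (fun y => θ y t) x)) =
        κ m a t * H t - κ m b t * H t + χ m t * R t := fun t => by
      rw [← setIntegral_eq_integral_of_forall_compl_eq_zero (s := Icc (-N) N) fun x hx => ?_]
      · have e1 : ∀ x, e (U x t) * deriv (fun s => θ x s) t + q (U x t) * deriv (fun y => θ y t) x
            = (κ m a t - κ m b t) * (e (U x t) * Φ x t) + χ m t * r x t := fun x => by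
          rw [(hθt x t).deriv, (hθx x t).deriv]; simp only [hr]; ring
        simp_rw [e1]
        rw [integral_add, integral_const_mul, integral_const_mul, sub_mul]
        · exact (integrable_restrict_of_bound
            (hslice (g := fun x t => e (U x t) * Φ x t) hhm t) (fun x => hbh x t) N).const_mul _
        · exact (integrable_restrict_of_bound (hslice hrm t) (fun x => hbr x t) N).const_mul _
      · have e1 : (fun s => θ x s) = fun _ => 0 := funext fun s => hθ0 x s hx
        have e2 : (fun y => θ y t) =ᶠ[𝓝 x] fun _ => 0 := by
          filter_upwards [isClosed_Icc.isOpen_compl.mem_nhds hx] with y hy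
          exact hθ0 y t hy
        rw [e1, e2.deriv_eq]
        simp
    simp_rw [hinner] at h
    rw [setIntegral_eq_integral_of_forall_compl_eq_zero fun t ht => ?_] at h
    · have hs : Integrable fun t => κ m a t * H t - κ m b t * H t := (hκH m a).sub (hκH m b)
      rwa [integral_add hs (hχR m), integral_sub (hκH m a) (hκH m b)] at h
    · have ht0 : t ≤ 0 := not_lt.1 ht
      have h1 : χ m t = 0 := by
        have h1 : ((m : ℝ) + 1) * (t - a) ≤ 0 :=
          mul_nonpos_of_nonneg_of_nonpos (by positivity) (by linarith)
        have h2 : ((m : ℝ) + 1) * (t - b) ≤ 0 :=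
          mul_nonpos_of_nonneg_of_nonpos (by positivity) (by linarith)
        simp [χ, Real.smoothTransition.zero_of_nonpos h1, Real.smoothTransition.zero_of_nonpos h2]
      rw [hκ0 m a t (by linarith), hκ0 m b t (by linarith), h1]
      simp
  have hlimR : Tendsto (fun m => ∫ t, χ m t * R t) atTop (𝓝 (∫ t in Icc a b, R t)) := by
    rw [integral_Icc_eq_integral_Ioc, ← integral_indicator measurableSet_Ioc]
    refine tendsto_integral_of_dominated_convergence
      ((Icc a (b + 1)).indicator fun _ => (Be * B + Bq * B) * (2 * N))
      (fun m => (hχR m).aestronglyMeasurable)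
      ((integrable_indicator_iff measurableSet_Icc).2 (integrable_const _))
      (fun m => Eventually.of_forall fun t => ?_) (Eventually.of_forall fun t => ?_)
    · by_cases ht : t ∈ Icc a (b + 1)
      · rw [indicator_of_mem ht, norm_mul, ← one_mul (_ * (2 * N))]
        exact mul_le_mul (hχb m t) (hRb t) (norm_nonneg _) zero_le_one
      · rw [indicator_of_notMem ht, hχ0 m t ht]; simp
    · have h1 := ((tendsto_smoothTransition_scaled t a).sub
        (tendsto_smoothTransition_scaled t b)).mul_const (R t)
      refine h1.trans_eq ?_
      congr 1
      by_cases h2 : a < t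
      · by_cases h3 : b < t
        · simp [h2, h3]
        · simp [h2, h3, indicator, not_lt.1 h3]
      · have h3 : ¬ b < t := fun h => h2 (hab.trans h)
        simp [h2, h3]
  have hlim := ((tendsto_integral_deriv_smoothTransition hHm hHb hHa).sub
    (tendsto_integral_deriv_smoothTransition hHm hHb hHc)).add hlimR
  have := ge_of_tendsto' hlim hineq
  linarith

/-- A bounded measurable function is an almost everywhere limit of smooth functions satisfying the
same bound. -/
theorem exists_contDiff_tendsto_ae {g : ℝ → ℝ} (hg : Measurable g) {K : ℝ} (hK : ∀ t, |g t| ≤ K) :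
    ∃ G : ℕ → ℝ → ℝ, (∀ n, ContDiff ℝ (⊤ : ℕ∞) (G n)) ∧ (∀ n t, |G n t| ≤ K) ∧
      ∀ᵐ t, Tendsto (fun n => G n t) atTop (𝓝 (g t)) := by
  have hloc : LocallyIntegrable g := by
    rw [locallyIntegrable_iff]
    intro k hk
    have : IsFiniteMeasure (volume.restrict k) := ⟨by simpa using hk.measure_lt_top⟩
    exact Integrable.of_bound hg.aestronglyMeasurable K (Eventually.of_forall hK)
  let φ : ℕ → ContDiffBump (0 : ℝ) := fun n =>
    ⟨1 / ((n : ℝ) + 1), 2 * (1 / ((n : ℝ) + 1)), by positivity, by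
      have : (0 : ℝ) < 1 / ((n : ℝ) + 1) := by positivity
      linarith⟩
  refine ⟨fun n => convolution ((φ n).normed volume) g (ContinuousLinearMap.lsmul ℝ ℝ) volume,
    fun n => ?_, fun n t => ?_, ?_⟩
  · exact (φ n).hasCompactSupport_normed.contDiff_convolution_left _ (φ n).contDiff_normed hloc
  · have h := norm_integral_le_of_norm_le (μ := volume)
      (f := fun s => ContinuousLinearMap.lsmul ℝ ℝ ((φ n).normed volume s) (g (t - s)))
      (g := fun s => (φ n).normed volume s * K) ((φ n).integrable_normed.mul_const K)
      (Eventually.of_forall fun s => by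
        simp only [ContinuousLinearMap.lsmul_apply, norm_smul, Real.norm_eq_abs,
          abs_of_nonneg ((φ n).nonneg_normed s)]
        exact mul_le_mul_of_nonneg_left (hK _) ((φ n).nonneg_normed s))
    rwa [integral_mul_const, (φ n).integral_normed, one_mul] at h
  · refine ContDiffBump.ae_convolution_tendsto_right_of_locallyIntegrable (K := 2) ?_
      (Eventually.of_forall fun n => le_rfl) hloc
    simpa [φ] using (tendsto_one_div_add_atTop_nhds_zero_nat (𝕜 := ℝ)).const_mul 2

/-- A Lipschitz curve is the primitive of a bounded measurable function. -/
theorem LipschitzOnWith.exists_bounded_velocity {x : ℝ → ℝ} {a b : ℝ} {K : NNReal}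
    (hx : LipschitzOnWith K x (Icc a b)) :
    ∃ g : ℝ → ℝ, Measurable g ∧ (∀ t, |g t| ≤ K) ∧
      (∀ t ∈ Icc a b, x t = x a + ∫ s in a..t, g s) ∧ ∀ t ∈ Ioo a b, g t = deriv x t := by
  refine ⟨(Ioo a b).indicator (deriv x), (measurable_deriv x).indicator measurableSet_Ioo,
    fun t => ?_, fun t ht => ?_, fun t ht => indicator_of_mem ht _⟩
  · by_cases ht : t ∈ Ioo a b
    · rw [indicator_of_mem ht]
      exact norm_deriv_le_of_lipschitzOn (Icc_mem_nhds ht.1 ht.2) hx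
    · simp [indicator_of_notMem ht]
  · have hac : AbsolutelyContinuousOnInterval x a t :=
      (hx.mono (by rw [uIcc_of_le ht.1]; exact Icc_subset_Icc_right ht.2)
        ).absolutelyContinuousOnInterval
    have h1 := hac.integral_deriv_eq_sub
    have h2 : ∫ s in a..t, (Ioo a b).indicator (deriv x) s = ∫ s in a..t, deriv x s := by
      rw [intervalIntegral.integral_of_le ht.1, intervalIntegral.integral_of_le ht.1,
        integral_Ioc_eq_integral_Ioo, integral_Ioc_eq_integral_Ioo]
      refine setIntegral_congr_fun measurableSet_Ioo fun s hs => ?_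
      exact indicator_of_mem (show s ∈ Ioo a b from ⟨hs.1, hs.2.trans_le ht.2⟩) _
    rw [h2, h1]; ring

/-- A smooth cutoff of the interval `[l, r]`. -/
def windowWeight (c l r x : ℝ) : ℝ :=
  Real.smoothTransition (c * (x - l)) * Real.smoothTransition (c * (r - x))

/-- The space-time flux through a moving smooth window with edges `l`, `r` of velocities `v`, `w`,
for a density `E` with flux `Q`. -/
def windowFlux (c l r v w E Q x : ℝ) : ℝ :=
  c * deriv Real.smoothTransition (c * (x - l)) * Real.smoothTransition (c * (r - x)) *
      (Q - v * E) -
    c * deriv Real.smoothTransition (c * (r - x)) * Real.smoothTransition (c * (x - l)) *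
      (Q - w * E)

theorem windowWeight_nonneg (c l r x : ℝ) : 0 ≤ windowWeight c l r x :=
  mul_nonneg (Real.smoothTransition.nonneg _) (Real.smoothTransition.nonneg _)

theorem windowWeight_le_one (c l r x : ℝ) : windowWeight c l r x ≤ 1 :=
  mul_le_one₀ (Real.smoothTransition.le_one _) (Real.smoothTransition.nonneg _)
    (Real.smoothTransition.le_one _)

theorem abs_windowWeight_le (c l r x : ℝ) : |windowWeight c l r x| ≤ 1 := by
  rw [abs_of_nonneg (windowWeight_nonneg _ _ _ _)]
  exact windowWeight_le_one _ _ _ _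

theorem windowWeight_eq_zero {c l r x : ℝ} (hc : 0 ≤ c) (h : x ∉ Ioo l r) :
    windowWeight c l r x = 0 := by
  unfold windowWeight
  rw [mem_Ioo, not_and_or, not_lt, not_lt] at h
  rcases h with h | h
  · rw [Real.smoothTransition.zero_of_nonpos
      (mul_nonpos_of_nonneg_of_nonpos hc (by linarith)), zero_mul]
  · rw [Real.smoothTransition.zero_of_nonpos (x := c * (r - x))
      (mul_nonpos_of_nonneg_of_nonpos hc (by linarith)), mul_zero]

theorem Measurable.windowWeight {α : Type*} [MeasurableSpace α] {l r x : α → ℝ}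
    (hl : Measurable l) (hr : Measurable r) (hx : Measurable x) (c : ℝ) :
    Measurable fun p => _root_.windowWeight c (l p) (r p) (x p) := by
  have := Real.smoothTransition.continuous.measurable
  unfold _root_.windowWeight
  fun_prop

theorem Measurable.windowFlux {α : Type*} [MeasurableSpace α] {l r v w E Q x : α → ℝ}
    (hl : Measurable l) (hr : Measurable r) (hv : Measurable v) (hw : Measurable w)
    (hE : Measurable E) (hQ : Measurable Q) (hx : Measurable x) (c : ℝ) :
    Measurable fun p => _root_.windowFlux c (l p) (r p) (v p) (w p) (E p) (Q p) (x p) := by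
  have := Real.smoothTransition.continuous.measurable
  have := continuous_deriv_smoothTransition.measurable
  unfold _root_.windowFlux
  fun_prop

theorem Filter.Tendsto.windowWeight {ι : Type*} {F : Filter ι} {l r : ι → ℝ} {l₀ r₀ : ℝ}
    (hl : Tendsto l F (𝓝 l₀)) (hr : Tendsto r F (𝓝 r₀)) (c x : ℝ) :
    Tendsto (fun i => _root_.windowWeight c (l i) (r i) x) F
      (𝓝 (_root_.windowWeight c l₀ r₀ x)) := by
  have hs := Real.smoothTransition.continuous
  exact ((hs.tendsto _).comp ((hl.const_sub x).const_mul c)).mul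
    ((hs.tendsto _).comp ((hr.sub_const x).const_mul c))

theorem Filter.Tendsto.windowFlux {ι : Type*} {F : Filter ι} {l r v w : ι → ℝ}
    {l₀ r₀ v₀ w₀ : ℝ} (hl : Tendsto l F (𝓝 l₀)) (hr : Tendsto r F (𝓝 r₀))
    (hv : Tendsto v F (𝓝 v₀)) (hw : Tendsto w F (𝓝 w₀)) (c E Q x : ℝ) :
    Tendsto (fun i => _root_.windowFlux c (l i) (r i) (v i) (w i) E Q x) F
      (𝓝 (_root_.windowFlux c l₀ r₀ v₀ w₀ E Q x)) := by
  have hs := Real.smoothTransition.continuous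
  have hs' := continuous_deriv_smoothTransition
  have hl' := (hl.const_sub x).const_mul c
  have hr' := (hr.sub_const x).const_mul c
  exact (((((hs'.tendsto _).comp hl').const_mul c).mul ((hs.tendsto _).comp hr')).mul
    ((hv.mul_const E).const_sub Q)).sub
    (((((hs'.tendsto _).comp hr').const_mul c).mul ((hs.tendsto _).comp hl')).mul
    ((hw.mul_const E).const_sub Q))

theorem abs_windowFlux_le {c S : ℝ} (hc : 0 ≤ c) (hS0 : 0 ≤ S)
    (hS : ∀ y, |deriv Real.smoothTransition y| ≤ S)
    {l r v w E Q x K Be Bq : ℝ} (hv : |v| ≤ K) (hw : |w| ≤ K) (hE : |E| ≤ Be) (hQ : |Q| ≤ Bq) :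
    |windowFlux c l r v w E Q x| ≤ 2 * (c * S * (Bq + K * Be)) := by
  have hK : 0 ≤ K := (abs_nonneg _).trans hv
  have key : ∀ y z u : ℝ, |u| ≤ K →
      |c * deriv Real.smoothTransition y * Real.smoothTransition z * (Q - u * E)|
        ≤ c * S * (Bq + K * Be) := fun y z u hu => by
    have h1 : |Q - u * E| ≤ Bq + K * Be := by
      refine (abs_sub _ _).trans (add_le_add hQ ?_)
      rw [abs_mul]
      exact mul_le_mul hu hE (abs_nonneg _) hK
    have h2 : |Real.smoothTransition z| ≤ 1 := by
      rw [abs_of_nonneg (Real.smoothTransition.nonneg _)]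
      exact Real.smoothTransition.le_one _
    rw [abs_mul, abs_mul, abs_mul, abs_of_nonneg hc]
    have h3 : c * |deriv Real.smoothTransition y| * |Real.smoothTransition z| ≤ c * S * 1 :=
      mul_le_mul (mul_le_mul_of_nonneg_left (hS y) hc) h2 (abs_nonneg _) (by positivity)
    rw [mul_one] at h3
    exact mul_le_mul h3 h1 (abs_nonneg _) (by positivity)
  refine (abs_sub _ _).trans ?_
  rw [two_mul]
  exact add_le_add (key _ _ _ hv) (key _ _ _ hw)

theorem contDiff_const_add_integral {g : ℝ → ℝ} (hg : ContDiff ℝ (⊤ : ℕ∞) g) (c a : ℝ) :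
    (∀ t, HasDerivAt (fun t => c + ∫ s in a..t, g s) (g t) t) ∧
      ContDiff ℝ (⊤ : ℕ∞) fun t => c + ∫ s in a..t, g s := by
  have hd : ∀ t, HasDerivAt (fun t => c + ∫ s in a..t, g s) (g t) t := fun t =>
    (hg.continuous.integral_hasStrictDerivAt a t).hasDerivAt.const_add c
  refine ⟨hd, contDiff_infty_iff_deriv.2 ⟨fun t => (hd t).differentiableAt, ?_⟩⟩
  rwa [funext fun t => (hd t).deriv]

theorem abs_const_add_integral_le {g : ℝ → ℝ} {K : ℝ} (hK : ∀ t, |g t| ≤ K) (c : ℝ) {a d t : ℝ}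
    (ht : t ∈ Icc a d) : |c + ∫ s in a..t, g s| ≤ |c| + K * (d - a) := by
  have hK0 : 0 ≤ K := (abs_nonneg _).trans (hK 0)
  have h := intervalIntegral.norm_integral_le_of_norm_le_const (a := a) (b := t) (f := g) (C := K)
    fun x _ => hK x
  rw [abs_of_nonneg (sub_nonneg.2 ht.1)] at h
  refine (abs_add_le _ _).trans (add_le_add le_rfl (h.trans ?_))
  exact mul_le_mul_of_nonneg_left (by linarith [ht.2]) hK0

/-- The entropy balance in a window with smooth edges. -/
theorem IsEntropySol.entropy_balance_window_smooth (hsol : IsEntropySol A U) (hcont : L1locCont U)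
    {e q : ℝ → ℝ} (he : ContDiff ℝ (⊤ : ℕ∞) e) (hq : ContDiff ℝ (⊤ : ℕ∞) q)
    (he2 : ∀ v, 0 ≤ deriv (deriv e) v) (heq : ∀ v, deriv q v = deriv e v * deriv A v)
    {N a b : ℝ} (hN : 0 < N) (ha : 0 ≤ a) (hab : a < b)
    {gL gR : ℝ → ℝ} (hgL : ContDiff ℝ (⊤ : ℕ∞) gL) (hgR : ContDiff ℝ (⊤ : ℕ∞) gR) {K cL cR : ℝ}
    (hKL : ∀ t, |gL t| ≤ K) (hKR : ∀ t, |gR t| ≤ K) (hNL : |cL| + K * (b + 1 - a) ≤ N)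
    (hNR : |cR| + K * (b + 1 - a) ≤ N) {c : ℝ} (hc : 0 ≤ c)
    {yL yR : ℝ → ℝ} (hyL : yL = fun t => cL + ∫ s in a..t, gL s)
    (hyR : yR = fun t => cR + ∫ s in a..t, gR s) :
    (∫ x in Icc (-N) N, e (U x b) * windowWeight c (yL b) (yR b) x) -
        (∫ x in Icc (-N) N, e (U x a) * windowWeight c (yL a) (yR a) x) ≤
      ∫ t in Icc a b, ∫ x in Icc (-N) N,
        windowFlux c (yL t) (yR t) (gL t) (gR t) (e (U x t)) (q (U x t)) x := by
  obtain ⟨hdL, hsL⟩ := contDiff_const_add_integral hgL cL a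
  obtain ⟨hdR, hsR⟩ := contDiff_const_add_integral hgR cR a
  rw [← hyL] at hdL hsL
  rw [← hyR] at hdR hsR
  obtain ⟨S, hS0, hS⟩ := exists_bound_deriv_smoothTransition
  have hK0 : 0 ≤ K := (abs_nonneg _).trans (hKL 0)
  have hs : ∀ y, HasDerivAt Real.smoothTransition (deriv Real.smoothTransition y) y := fun y =>
    contDiff_smoothTransition.hasDerivAt_smooth y
  have hΦ : ContDiff ℝ (⊤ : ℕ∞) fun p : ℝ × ℝ => windowWeight c (yL p.2) (yR p.2) p.1 := by
    unfold windowWeight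
    exact (contDiff_smoothTransition.comp (contDiff_const.mul
      (contDiff_fst.sub (hsL.comp contDiff_snd)))).mul
      (contDiff_smoothTransition.comp (contDiff_const.mul
      ((hsR.comp contDiff_snd).sub contDiff_fst)))
  have hdt : ∀ x t, HasDerivAt (fun s => windowWeight c (yL s) (yR s) x)
      (windowFlux c (yL t) (yR t) (gL t) (gR t) 1 0 x) t := fun x t => by
    have h1 := (hs (c * (x - yL t))).comp t (((hdL t).const_sub x).const_mul c)
    have h2 := (hs (c * (yR t - x))).comp t (((hdR t).sub_const x).const_mul c)
    refine (h1.mul h2).congr_deriv ?_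
    simp only [windowFlux, Function.comp_apply]
    ring
  have hdx : ∀ x t, HasDerivAt (fun y => windowWeight c (yL t) (yR t) y)
      (windowFlux c (yL t) (yR t) (gL t) (gR t) 0 1 x) x := fun x t => by
    have h1 := (hs (c * (x - yL t))).comp x (((hasDerivAt_id x).sub_const (yL t)).const_mul c)
    have h2 := (hs (c * (yR t - x))).comp x (((hasDerivAt_id x).const_sub (yR t)).const_mul c)
    refine (h1.mul h2).congr_deriv ?_
    simp only [windowFlux, Function.comp_apply, id]
    ring
  have hsplit : ∀ x t E Q, E * windowFlux c (yL t) (yR t) (gL t) (gR t) 1 0 x +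
      Q * windowFlux c (yL t) (yR t) (gL t) (gR t) 0 1 x =
      windowFlux c (yL t) (yR t) (gL t) (gR t) E Q x := fun x t E Q => by
    simp only [windowFlux]; ring
  have hp : 0 ≤ 2 * (c * S * (1 + K * 1)) := by positivity
  have h := hsol.entropy_balance hcont he hq he2 heq
    (Φ := fun x t => windowWeight c (yL t) (yR t) x) hΦ
    (fun x t => windowWeight_nonneg _ _ _ _) (B := 1 + 2 * (c * S * (1 + K * 1)))
    (fun x t => (abs_windowWeight_le _ _ _ _).trans (by linarith))
    (fun x t => by
      rw [(hdt x t).deriv]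
      have := abs_windowFlux_le hc hS0 hS (hKL t) (hKR t) (E := 1) (Q := 0) (Be := 1) (Bq := 1)
        (l := yL t) (r := yR t) (x := x) (by simp) (by simp)
      linarith)
    (fun x t => by
      rw [(hdx x t).deriv]
      have := abs_windowFlux_le hc hS0 hS (hKL t) (hKR t) (E := 0) (Q := 1) (Be := 1) (Bq := 1)
        (l := yL t) (r := yR t) (x := x) (by simp) (by simp)
      linarith)
    hN ha hab (fun t ht x hx => by
      refine windowWeight_eq_zero hc fun hx' => hx ?_
      have h1 := (abs_const_add_integral_le hKL cL ht).trans hNL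
      have h2 := (abs_const_add_integral_le hKR cR ht).trans hNR
      rw [hyL, hyR] at hx'
      exact ⟨(abs_le.1 h1).1.trans hx'.1.le, hx'.2.le.trans (abs_le.1 h2).2⟩)
  refine h.trans_eq ?_
  refine integral_congr_ae (Eventually.of_forall fun t => ?_)
  refine integral_congr_ae (Eventually.of_forall fun x => ?_)
  simp only
  rw [(hdt x t).deriv, (hdx x t).deriv, hsplit]

/-- The entropy balance in a window with Lipschitz edges. -/
theorem IsEntropySol.entropy_balance_window (hsol : IsEntropySol A U) (hcont : L1locCont U)
    {e q : ℝ → ℝ} (he : ContDiff ℝ (⊤ : ℕ∞) e) (hq : ContDiff ℝ (⊤ : ℕ∞) q)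
    (he2 : ∀ v, 0 ≤ deriv (deriv e) v) (heq : ∀ v, deriv q v = deriv e v * deriv A v)
    {N a b : ℝ} (hN : 0 < N) (ha : 0 ≤ a) (hab : a < b)
    {gL gR : ℝ → ℝ} (hgL : Measurable gL) (hgR : Measurable gR) {K cL cR : ℝ}
    (hKL : ∀ t, |gL t| ≤ K) (hKR : ∀ t, |gR t| ≤ K) (hNL : |cL| + K * (b + 1 - a) ≤ N)
    (hNR : |cR| + K * (b + 1 - a) ≤ N) {c : ℝ} (hc : 0 ≤ c)
    {yL yR : ℝ → ℝ} (hyL : yL = fun t => cL + ∫ s in a..t, gL s)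
    (hyR : yR = fun t => cR + ∫ s in a..t, gR s) :
    (∫ x in Icc (-N) N, e (U x b) * windowWeight c (yL b) (yR b) x) -
        (∫ x in Icc (-N) N, e (U x a) * windowWeight c (yL a) (yR a) x) ≤
      ∫ t in Icc a b, ∫ x in Icc (-N) N,
        windowFlux c (yL t) (yR t) (gL t) (gR t) (e (U x t)) (q (U x t)) x := by
  obtain ⟨M, hM⟩ := hsol.bounded
  have hm := hsol.measurable
  obtain ⟨Be, hBe0, hBe⟩ := exists_bound_comp he.continuous M
  obtain ⟨Bq, hBq0, hBq⟩ := exists_bound_comp hq.continuous M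
  obtain ⟨S, hS0, hS⟩ := exists_bound_deriv_smoothTransition
  have hEm : Measurable fun p : ℝ × ℝ => e (U p.1 p.2) := he.continuous.measurable.comp hm
  have hQm : Measurable fun p : ℝ × ℝ => q (U p.1 p.2) := hq.continuous.measurable.comp hm
  obtain ⟨VL, hVLs, hVLb, hVLt⟩ := exists_contDiff_tendsto_ae hgL hKL
  obtain ⟨VR, hVRs, hVRb, hVRt⟩ := exists_contDiff_tendsto_ae hgR hKR
  have hY : ∀ {g : ℝ → ℝ} {G : ℕ → ℝ → ℝ} (c₀ : ℝ), (∀ n, ContDiff ℝ (⊤ : ℕ∞) (G n)) →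
      (∀ n t, |G n t| ≤ K) → (∀ᵐ t, Tendsto (fun n => G n t) atTop (𝓝 (g t))) →
      ∀ t, Tendsto (fun n => c₀ + ∫ s in a..t, G n s) atTop (𝓝 (c₀ + ∫ s in a..t, g s)) :=
    fun c₀ hs hb ht t => by
      refine Tendsto.const_add _ ?_
      refine intervalIntegral.tendsto_integral_filter_of_dominated_convergence (fun _ => K)
        (Eventually.of_forall fun n => (hs n).continuous.aestronglyMeasurable)
        (Eventually.of_forall fun n => Eventually.of_forall fun s _ => hb n s)
        intervalIntegrable_const ?_
      filter_upwards [ht] with s hs _ using hs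
  have hYL := hY cL hVLs hVLb hVLt
  have hYR := hY cR hVRs hVRb hVRt
  have hW : ∀ t, Tendsto (fun n => ∫ x in Icc (-N) N, e (U x t) *
      windowWeight c (cL + ∫ s in a..t, VL n s) (cR + ∫ s in a..t, VR n s) x) atTop
      (𝓝 (∫ x in Icc (-N) N, e (U x t) * windowWeight c (yL t) (yR t) x)) := fun t => by
    refine tendsto_integral_of_dominated_convergence (fun _ => Be * 1) (fun n => ?_)
      (integrable_const _) (fun n => Eventually.of_forall fun x => ?_)
      (Eventually.of_forall fun x => ?_)
    · exact ((hEm.comp (measurable_id.prodMk measurable_const)).mul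
        (measurable_const.windowWeight measurable_const measurable_id c)).aestronglyMeasurable
    · rw [norm_mul]
      exact mul_le_mul (hBe _ (hM _ _)) (abs_windowWeight_le _ _ _ _) (norm_nonneg _) hBe0
    · refine Tendsto.const_mul _ ?_
      rw [hyL, hyR]
      exact (hYL t).windowWeight (hYR t) c x
  have hF : Tendsto (fun n => ∫ t in Icc a b, ∫ x in Icc (-N) N,
      windowFlux c (cL + ∫ s in a..t, VL n s) (cR + ∫ s in a..t, VR n s) (VL n t) (VR n t)
        (e (U x t)) (q (U x t)) x) atTop
      (𝓝 (∫ t in Icc a b, ∫ x in Icc (-N) N,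
        windowFlux c (yL t) (yR t) (gL t) (gR t) (e (U x t)) (q (U x t)) x)) := by
    have hfm : ∀ n, Measurable fun p : ℝ × ℝ =>
        windowFlux c (cL + ∫ s in a..p.1, VL n s) (cR + ∫ s in a..p.1, VR n s) (VL n p.1)
          (VR n p.1) (e (U p.2 p.1)) (q (U p.2 p.1)) p.2 := fun n => by
      have h1 := (contDiff_const_add_integral (hVLs n) cL a).2.continuous.measurable
      have h2 := (contDiff_const_add_integral (hVRs n) cR a).2.continuous.measurable
      exact (h1.comp measurable_fst).windowFlux (h2.comp measurable_fst)
        ((hVLs n).continuous.measurable.comp measurable_fst)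
        ((hVRs n).continuous.measurable.comp measurable_fst)
        (hEm.comp measurable_swap) (hQm.comp measurable_swap) measurable_snd c
    have hfb : ∀ n t x, |windowFlux c (cL + ∫ s in a..t, VL n s) (cR + ∫ s in a..t, VR n s)
        (VL n t) (VR n t) (e (U x t)) (q (U x t)) x| ≤ 2 * (c * S * (Bq + K * Be)) :=
      fun n t x => abs_windowFlux_le hc hS0 hS (hVLb n t) (hVRb n t) (hBe _ (hM _ _))
        (hBq _ (hM _ _))
    refine tendsto_integral_of_dominated_convergence
      (fun _ => 2 * (c * S * (Bq + K * Be)) * (2 * N)) (fun n => ?_) (integrable_const _)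
      (fun n => Eventually.of_forall fun t => ?_) ?_
    · exact ((hfm n).stronglyMeasurable.integral_prod_right
        (ν := volume.restrict (Icc (-N) N))
        (f := fun t x => windowFlux c (cL + ∫ s in a..t, VL n s) (cR + ∫ s in a..t, VR n s)
          (VL n t) (VR n t) (e (U x t)) (q (U x t)) x)).aestronglyMeasurable
    · exact abs_setIntegral_le_of_bound hN.le fun x => hfb n t x
    · filter_upwards [ae_restrict_of_ae hVLt, ae_restrict_of_ae hVRt] with t htL htR
      refine tendsto_integral_of_dominated_convergence
        (fun _ => 2 * (c * S * (Bq + K * Be))) (fun n => ?_) (integrable_const _)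
        (fun n => Eventually.of_forall fun x => hfb n t x) (Eventually.of_forall fun x => ?_)
      · exact ((hfm n).comp (measurable_const.prodMk measurable_id)).aestronglyMeasurable
      · rw [hyL, hyR]
        exact (hYL t).windowFlux (hYR t) htL htR c _ _ x
  exact le_of_tendsto_of_tendsto' ((hW b).sub (hW a)) hF fun n =>
    hsol.entropy_balance_window_smooth hcont he hq he2 heq hN ha hab (hVLs n) (hVRs n)
      (hVLb n) (hVRb n) hNL hNR hc rfl rfl

/-- The mass of the kernel at the left edge of a window is bounded independently of its width. -/
theorem abs_integral_edge_le {V : ℝ → ℝ} {B : ℝ} (hB : ∀ x, |V x| ≤ B) {c : ℝ} (hc : 0 < c)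
    (l r N : ℝ) :
    |∫ x in Icc (-N) N, c * deriv Real.smoothTransition (c * (x - l)) *
      Real.smoothTransition (c * (r - x)) * V x| ≤
      B * ∫ y, |deriv Real.smoothTransition y| := by
  have hB0 : 0 ≤ B := (abs_nonneg _).trans (hB 0)
  have hi : Integrable fun x => c * |deriv Real.smoothTransition (c * (x - l))| * B := by
    have h1 := integrable_deriv_smoothTransition.abs.comp_mul_left' (R := c) hc.ne'
    exact ((h1.comp_sub_right l).const_mul c).mul_const B
  have h1 := norm_integral_le_of_norm_le (μ := volume.restrict (Icc (-N) N))
    (f := fun x => c * deriv Real.smoothTransition (c * (x - l)) *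
      Real.smoothTransition (c * (r - x)) * V x) hi.integrableOn (Eventually.of_forall fun x => by
        rw [Real.norm_eq_abs, abs_mul, abs_mul, abs_mul, abs_of_pos hc,
          abs_of_nonneg (Real.smoothTransition.nonneg _)]
        refine mul_le_mul ?_ (hB x) (abs_nonneg _) (by positivity)
        exact mul_le_of_le_one_right (by positivity) (Real.smoothTransition.le_one _))
  refine h1.trans ((setIntegral_le_integral hi
    (Eventually.of_forall fun x => by simp only [Pi.zero_apply]; positivity)).trans_eq ?_)
  rw [integral_mul_const, integral_const_mul,
    integral_sub_right_eq_self (fun x => |deriv Real.smoothTransition (c * x)|) l,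
    Measure.integral_comp_mul_left (fun y => |deriv Real.smoothTransition y|),
    abs_of_pos (inv_pos.2 hc), smul_eq_mul, mul_inv_cancel_left₀ hc.ne', mul_comm]

/-- The kernel at the left edge of a shrinking window captures the right trace. -/
theorem tendsto_integral_edge {V : ℝ → ℝ} (hV : Measurable V) {B : ℝ} (hB : ∀ x, |V x| ≤ B)
    {l r v N : ℝ} (hlr : l < r) (hl : -N ≤ l) (hr : r ≤ N)
    (hv : Tendsto V (𝓝[>] l) (𝓝 v)) :
    Tendsto (fun m : ℕ => ∫ x in Icc (-N) N,
      ((m : ℝ) + 1) * deriv Real.smoothTransition (((m : ℝ) + 1) * (x - l)) *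
        Real.smoothTransition (((m : ℝ) + 1) * (r - x)) * V x) atTop (𝓝 v) := by
  have hvB : |v| ≤ B := le_of_tendsto hv.abs (Eventually.of_forall hB)
  let h : ℝ → ℝ := fun x => if l < x then V x else v
  have hhl : h l = v := by simp [h]
  have hh : Tendsto h (𝓝[≥] l) (𝓝 (h l)) := by
    rw [← Ioi_insert, nhdsWithin_insert, tendsto_sup]
    refine ⟨tendsto_pure_nhds h l, ?_⟩
    rw [hhl]
    refine hv.congr' ?_
    filter_upwards [self_mem_nhdsWithin] with x hx
    simp [h, hx.out]
  have hlim := tendsto_integral_deriv_smoothTransition (h := h)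
    (Measurable.ite measurableSet_Ioi hV measurable_const) (B := B)
    (fun x => by simp only [h]; split_ifs; exacts [hB x, hvB]) hh
  rw [hhl] at hlim
  refine hlim.congr' ?_
  have hev : ∀ᶠ m : ℕ in atTop, 2 / (r - l) ≤ (m : ℝ) + 1 :=
    (tendsto_natCast_atTop_atTop.atTop_add tendsto_const_nhds).eventually_ge_atTop _
  filter_upwards [hev] with m hm
  rw [div_le_iff₀ (sub_pos.2 hlr)] at hm
  have hc : (0 : ℝ) < (m : ℝ) + 1 := by positivity
  have hright : ∀ x, 1 < ((m : ℝ) + 1) * (x - l) →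
      deriv Real.smoothTransition (((m : ℝ) + 1) * (x - l)) = 0 := fun x hx =>
    deriv_smoothTransition_eq_zero fun h' => absurd h'.2 (not_le.2 hx)
  have hleft : ∀ x, x ≤ l → deriv Real.smoothTransition (((m : ℝ) + 1) * (x - l)) = 0 :=
    fun x hx => deriv_smoothTransition_of_nonpos
      (mul_nonpos_of_nonneg_of_nonpos hc.le (by linarith))
  rw [setIntegral_eq_integral_of_forall_compl_eq_zero]
  · congr 1
    ext x
    rcases le_or_gt x l with hx | hx
    · simp [hleft x hx]
    · rcases lt_or_ge 1 (((m : ℝ) + 1) * (x - l)) with h1 | h1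
      · simp [hright x h1]
      · rw [Real.smoothTransition.one_of_one_le (x := ((m : ℝ) + 1) * (r - x)) (by nlinarith)]
        simp [h, hx]
  · intro x hx
    rw [mem_Icc, not_and_or, not_le, not_le] at hx
    rcases hx with hx | hx
    · simp [hleft x (by linarith)]
    · rw [hright x (by nlinarith)]; simp

theorem integral_edge_reflect (V : ℝ → ℝ) (c l r N : ℝ) :
    ∫ x in Icc (-N) N, c * deriv Real.smoothTransition (c * (r - x)) *
      Real.smoothTransition (c * (x - l)) * V x =
    ∫ x in Icc (-N) N, c * deriv Real.smoothTransition (c * (x - -r)) *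
      Real.smoothTransition (c * (-l - x)) * V (-x) := by
  have h := (Measure.measurePreserving_neg (volume : Measure ℝ)).setIntegral_preimage_emb
    (MeasurableEquiv.neg ℝ).measurableEmbedding
    (fun x => c * deriv Real.smoothTransition (c * (r - x)) *
      Real.smoothTransition (c * (x - l)) * V x) (Icc (-N) N)
  rw [← h]
  have e : (fun x : ℝ => -x) ⁻¹' Icc (-N) N = Icc (-N) N := by
    ext x; simp only [mem_preimage, mem_Icc]; constructor <;> rintro ⟨h1, h2⟩ <;> constructor <;>
      linarith
  rw [show (Neg.neg ⁻¹' Icc (-N) N : Set ℝ) = Icc (-N) N from e]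
  refine integral_congr_ae (Eventually.of_forall fun x => ?_)
  simp only
  rw [show r - -x = x - -r by ring, show -x - l = -l - x by ring]

theorem tendsto_integral_windowWeight {V : ℝ → ℝ} (hV : Measurable V) {B : ℝ}
    (hB : ∀ x, |V x| ≤ B) {l r N : ℝ} (hlr : l ≤ r) (hl : -N ≤ l) (hr : r ≤ N) :
    Tendsto (fun m : ℕ => ∫ x in Icc (-N) N, V x * windowWeight ((m : ℝ) + 1) l r x) atTop
      (𝓝 (∫ x in l..r, V x)) := by
  have e : ∫ x in l..r, V x = ∫ x in Icc (-N) N, (Ioo l r).indicator V x := by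
    rw [intervalIntegral.integral_of_le hlr, integral_Ioc_eq_integral_Ioo,
      setIntegral_indicator measurableSet_Ioo, inter_eq_right.2
      (Ioo_subset_Icc_self.trans (Icc_subset_Icc hl hr))]
  rw [e]
  refine tendsto_integral_of_dominated_convergence (fun _ => B * 1) (fun m => ?_)
    (integrable_const _) (fun m => Eventually.of_forall fun x => ?_)
    (Eventually.of_forall fun x => ?_)
  · exact (hV.mul (measurable_const.windowWeight measurable_const measurable_id
      _)).aestronglyMeasurable
  · rw [norm_mul]
    exact mul_le_mul (hB _) (abs_windowWeight_le _ _ _ _) (norm_nonneg _)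
      ((abs_nonneg _).trans (hB 0))
  · by_cases hx : x ∈ Ioo l r
    · rw [indicator_of_mem hx]
      have h1 := tendsto_smoothTransition_scaled x l
      have h2 := tendsto_smoothTransition_scaled r x
      rw [if_pos hx.1] at h1
      rw [if_pos hx.2] at h2
      simpa [windowWeight] using (h1.mul h2).const_mul (V x)
    · rw [indicator_of_notMem hx]
      refine tendsto_const_nhds.congr fun m => ?_
      rw [windowWeight_eq_zero (by positivity) hx, mul_zero]

theorem integral_windowFlux {E Q : ℝ → ℝ} (hE : Measurable E) (hQ : Measurable Q) {Be Bq : ℝ}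
    (hBe : ∀ x, |E x| ≤ Be) (hBq : ∀ x, |Q x| ≤ Bq) {c : ℝ} (hc : 0 ≤ c) (l r v w N : ℝ) :
    ∫ x in Icc (-N) N, windowFlux c l r v w (E x) (Q x) x =
      (∫ x in Icc (-N) N, c * deriv Real.smoothTransition (c * (x - l)) *
        Real.smoothTransition (c * (r - x)) * (Q x - v * E x)) -
      ∫ x in Icc (-N) N, c * deriv Real.smoothTransition (c * (x - -r)) *
        Real.smoothTransition (c * (-l - x)) * (Q (-x) - w * E (-x)) := by
  obtain ⟨S, hS0, hS⟩ := exists_bound_deriv_smoothTransition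
  have hms := Real.smoothTransition.continuous.measurable
  have hms' := continuous_deriv_smoothTransition.measurable
  have key : ∀ (y z : ℝ → ℝ) (u : ℝ), Measurable y → Measurable z →
      Integrable (fun x => c * deriv Real.smoothTransition (y x) *
        Real.smoothTransition (z x) * (Q x - u * E x)) (volume.restrict (Icc (-N) N)) :=
    fun y z u hy hz => by
      refine integrable_restrict_of_bound (by fun_prop) (B := c * S * (Bq + |u| * Be))
        (fun x => ?_) N
      have h1 : |Q x - u * E x| ≤ Bq + |u| * Be := by
        refine (abs_sub _ _).trans (add_le_add (hBq x) ?_)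
        rw [abs_mul]
        exact mul_le_mul_of_nonneg_left (hBe x) (abs_nonneg _)
      rw [abs_mul, abs_mul, abs_mul, abs_of_nonneg hc,
        abs_of_nonneg (Real.smoothTransition.nonneg _)]
      refine mul_le_mul ?_ h1 (abs_nonneg _) (by positivity)
      exact (mul_le_of_le_one_right (by positivity) (Real.smoothTransition.le_one _)).trans
        (mul_le_mul_of_nonneg_left (hS _) hc)
  rw [← integral_edge_reflect (fun x => Q x - w * E x) c l r N, ← integral_sub]
  · rfl
  · exact key _ _ _ (by fun_prop) (by fun_prop)
  · exact key _ _ _ (by fun_prop) (by fun_prop)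

/-- The entropy balance between two Lipschitz curves, in terms of the traces of the solution on
the inner sides of the curves. -/
theorem IsEntropySol.entropy_balance_curves {Um Up : ℝ → ℝ → ℝ} (hsol : IsEntropySol A U)
    (hlim : HasSideLimits U Um Up) (hcont : L1locCont U)
    {e q : ℝ → ℝ} (he : ContDiff ℝ (⊤ : ℕ∞) e) (hq : ContDiff ℝ (⊤ : ℕ∞) q)
    (he2 : ∀ v, 0 ≤ deriv (deriv e) v) (heq : ∀ v, deriv q v = deriv e v * deriv A v)
    {a b : ℝ} (ha : 0 ≤ a) (hab : a < b) {xL xR : ℝ → ℝ} {KL KR : NNReal}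
    (hxL : LipschitzOnWith KL xL (Icc a b)) (hxR : LipschitzOnWith KR xR (Icc a b))
    (hlt : ∀ t ∈ Icc a b, xL t < xR t) :
    IntegrableOn (fun t => (q (Up (xL t) t) - deriv xL t * e (Up (xL t) t)) -
        (q (Um (xR t) t) - deriv xR t * e (Um (xR t) t))) (Icc a b) ∧
      (∫ x in xL b..xR b, e (U x b)) - (∫ x in xL a..xR a, e (U x a)) ≤
        ∫ t in Icc a b, ((q (Up (xL t) t) - deriv xL t * e (Up (xL t) t)) -
          (q (Um (xR t) t) - deriv xR t * e (Um (xR t) t))) := by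
  obtain ⟨M, hM⟩ := hsol.bounded
  have hm := hsol.measurable
  obtain ⟨Be, hBe0, hBe⟩ := exists_bound_comp he.continuous M
  obtain ⟨Bq, hBq0, hBq⟩ := exists_bound_comp hq.continuous M
  have hEm : Measurable fun p : ℝ × ℝ => e (U p.1 p.2) := he.continuous.measurable.comp hm
  have hQm : Measurable fun p : ℝ × ℝ => q (U p.1 p.2) := hq.continuous.measurable.comp hm
  have hEt : ∀ t, Measurable fun x => e (U x t) := fun t =>
    hEm.comp (measurable_id.prodMk measurable_const)
  have hQt : ∀ t, Measurable fun x => q (U x t) := fun t =>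
    hQm.comp (measurable_id.prodMk measurable_const)
  obtain ⟨gL, hgL, hgLb, hgLx, hgLd⟩ := hxL.exists_bounded_velocity
  obtain ⟨gR, hgR, hgRb, hgRx, hgRd⟩ := hxR.exists_bounded_velocity
  let K : ℝ := max KL KR
  have hK0 : 0 ≤ K := le_max_of_le_left KL.2
  have hKL : ∀ t, |gL t| ≤ K := fun t => (hgLb t).trans (le_max_left _ _)
  have hKR : ∀ t, |gR t| ≤ K := fun t => (hgRb t).trans (le_max_right _ _)
  let N : ℝ := max |xL a| |xR a| + K * (b + 1 - a) + 1
  have hKN : 0 ≤ K * (b + 1 - a) := mul_nonneg hK0 (by linarith)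
  have hN : 0 < N := by
    have : 0 ≤ max |xL a| |xR a| := le_max_of_le_left (abs_nonneg _)
    simp only [N]; linarith
  have hNL : |xL a| + K * (b + 1 - a) ≤ N := by
    have := le_max_left |xL a| |xR a|
    simp only [N]; linarith
  have hNR : |xR a| + K * (b + 1 - a) ≤ N := by
    have := le_max_right |xL a| |xR a|
    simp only [N]; linarith
  have hsub : ∀ {t}, t ∈ Icc a b → t ∈ Icc a (b + 1) := fun ht => ⟨ht.1, by linarith [ht.2]⟩
  have hxLN : ∀ t ∈ Icc a b, |xL t| ≤ N := fun t ht => by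
    rw [hgLx t ht]; exact (abs_const_add_integral_le hKL (xL a) (hsub ht)).trans hNL
  have hxRN : ∀ t ∈ Icc a b, |xR t| ≤ N := fun t ht => by
    rw [hgRx t ht]; exact (abs_const_add_integral_le hKR (xR a) (hsub ht)).trans hNR
  have ha' : a ∈ Icc a b := ⟨le_rfl, hab.le⟩
  have hb' : b ∈ Icc a b := ⟨hab.le, le_rfl⟩
  let yL : ℝ → ℝ := fun t => xL a + ∫ s in a..t, gL s
  let yR : ℝ → ℝ := fun t => xR a + ∫ s in a..t, gR s
  let R : ℕ → ℝ → ℝ := fun m t => ∫ x in Icc (-N) N,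
    windowFlux ((m : ℝ) + 1) (yL t) (yR t) (gL t) (gR t) (e (U x t)) (q (U x t)) x
  let P : ℝ → ℝ := fun t => (q (Up (xL t) t) - deriv xL t * e (Up (xL t) t)) -
    (q (Um (xR t) t) - deriv xR t * e (Um (xR t) t))
  let Z : ℝ := ∫ y, |deriv Real.smoothTransition y|
  have hbal : ∀ m : ℕ, (∫ x in Icc (-N) N, e (U x b) * windowWeight ((m : ℝ) + 1) (xL b) (xR b) x) -
      (∫ x in Icc (-N) N, e (U x a) * windowWeight ((m : ℝ) + 1) (xL a) (xR a) x) ≤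
      ∫ t in Icc a b, R m t := fun m => by
    have h := hsol.entropy_balance_window hcont he hq he2 heq hN ha hab hgL hgR hKL hKR hNL hNR
      (c := (m : ℝ) + 1) (by positivity) (yL := yL) (yR := yR) rfl rfl
    simp only [yL, yR] at h
    rw [← hgLx b hb', ← hgRx b hb', ← hgLx a ha', ← hgRx a ha'] at h
    exact h
  have hVb : ∀ {u t x : ℝ}, |u| ≤ K → |q (U x t) - u * e (U x t)| ≤ Bq + K * Be :=
    fun {u t x} hu => by
      refine (abs_sub _ _).trans (add_le_add (hBq _ (hM _ _)) ?_)
      rw [abs_mul]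
      exact mul_le_mul hu (hBe _ (hM _ _)) (abs_nonneg _) hK0
  have hVm : ∀ u t : ℝ, Measurable fun x => q (U x t) - u * e (U x t) := fun u t =>
    (hQt t).sub ((hEt t).const_mul u)
  have hRsplit : ∀ m t, R m t = _ := fun m t =>
    integral_windowFlux (hEt t) (hQt t) (fun x => hBe _ (hM _ _)) (fun x => hBq _ (hM _ _))
      (by positivity : (0 : ℝ) ≤ (m : ℝ) + 1) (yL t) (yR t) (gL t) (gR t) N
  have hRb : ∀ m t, |R m t| ≤ 2 * ((Bq + K * Be) * Z) := fun m t => by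
    rw [hRsplit, two_mul]
    refine (abs_sub _ _).trans (add_le_add ?_ ?_)
    · exact abs_integral_edge_le (fun x => hVb (hKL t)) (by positivity) _ _ _
    · exact abs_integral_edge_le (V := fun x => q (U (-x) t) - gR t * e (U (-x) t))
        (fun x => hVb (hKR t)) (by positivity) _ _ _
  have hRm : ∀ m, AEStronglyMeasurable (R m) (volume.restrict (Icc a b)) := fun m => by
    have hY : ∀ {g : ℝ → ℝ} (c₀ : ℝ), Measurable g → (∀ t, |g t| ≤ K) →
        Measurable fun t => c₀ + ∫ s in a..t, g s := fun {g} c₀ hg hgb => by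
      refine (continuous_const.add (intervalIntegral.continuous_primitive (fun x y => ?_)
        a)).measurable
      exact (intervalIntegrable_const (c := K)).mono_fun' hg.aestronglyMeasurable
        (Eventually.of_forall hgb)
    have h1 := hY (xL a) hgL hKL
    have h2 := hY (xR a) hgR hKR
    have hf : Measurable fun p : ℝ × ℝ => windowFlux ((m : ℝ) + 1) (yL p.1) (yR p.1) (gL p.1)
        (gR p.1) (e (U p.2 p.1)) (q (U p.2 p.1)) p.2 :=
      (h1.comp measurable_fst).windowFlux (h2.comp measurable_fst) (hgL.comp measurable_fst)
        (hgR.comp measurable_fst) (hEm.comp measurable_swap) (hQm.comp measurable_swap)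
        measurable_snd _
    exact (hf.stronglyMeasurable.integral_prod_right (ν := volume.restrict (Icc (-N) N))
      (f := fun t x => windowFlux ((m : ℝ) + 1) (yL t) (yR t) (gL t) (gR t) (e (U x t))
        (q (U x t)) x)).aestronglyMeasurable
  have hRlim : ∀ᵐ t ∂(volume.restrict (Icc a b)), Tendsto (fun m => R m t) atTop (𝓝 (P t)) := by
    rw [← restrict_Ioo_eq_restrict_Icc]
    refine (ae_restrict_iff' measurableSet_Ioo).2 (Eventually.of_forall fun t ht => ?_)
    have ht' : t ∈ Icc a b := Ioo_subset_Icc_self ht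
    have ht0 : 0 < t := ha.trans_lt ht.1
    have hyL : yL t = xL t := (hgLx t ht').symm
    have hyR : yR t = xR t := (hgRx t ht').symm
    have hl := abs_le.1 (hxLN t ht')
    have hr := abs_le.1 (hxRN t ht')
    have hUl := hlim.right (xL t) t ht0
    have hUr : Tendsto (fun x => U (-x) t) (𝓝[>] (-xR t)) (𝓝 (Um (xR t) t)) :=
      (hlim.left (xR t) t ht0).comp tendsto_neg_nhdsGT_neg
    simp_rw [hRsplit, hyL, hyR, hgLd t ht, hgRd t ht]
    refine Tendsto.sub ?_ ?_
    · refine tendsto_integral_edge (hVm _ t) (B := Bq + K * Be) (fun x => hVb ?_) (hlt t ht')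
        hl.1 hr.2 ?_
      · rw [← hgLd t ht]; exact hKL t
      · exact ((hq.continuous.tendsto _).comp hUl).sub
          (((he.continuous.tendsto _).comp hUl).const_mul _)
    · refine tendsto_integral_edge (V := fun x => q (U (-x) t) - deriv xR t * e (U (-x) t))
        ((hVm _ t).comp measurable_neg) (B := Bq + K * Be) (fun x => hVb ?_)
        (neg_lt_neg (hlt t ht')) (neg_le_neg hr.2) (by linarith) ?_
      · rw [← hgRd t ht]; exact hKR t
      · exact ((hq.continuous.tendsto _).comp hUr).sub
          (((he.continuous.tendsto _).comp hUr).const_mul _)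
  have hPm : AEStronglyMeasurable P (volume.restrict (Icc a b)) :=
    aestronglyMeasurable_of_tendsto_ae atTop hRm hRlim
  refine ⟨Integrable.of_bound hPm (2 * ((Bq + K * Be) * Z)) ?_, ?_⟩
  · filter_upwards [hRlim] with t ht
    exact le_of_tendsto ht.norm (Eventually.of_forall fun m => hRb m t)
  · refine le_of_tendsto_of_tendsto' (Tendsto.sub ?_ ?_)
      (tendsto_integral_of_dominated_convergence (fun _ => 2 * ((Bq + K * Be) * Z)) hRm
        (integrable_const _) (fun m => Eventually.of_forall fun t => hRb m t) hRlim) hbal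
    · exact tendsto_integral_windowWeight (hEt b) (fun x => hBe _ (hM _ _)) (hlt b hb').le
        (abs_le.1 (hxLN b hb')).1 (abs_le.1 (hxRN b hb')).2
    · exact tendsto_integral_windowWeight (hEt a) (fun x => hBe _ (hM _ _)) (hlt a ha').le
        (abs_le.1 (hxLN a ha')).1 (abs_le.1 (hxRN a ha')).2

end WeakBalance

/-- **Lemma 3.4.** If `x_L, x_R` are Filippov solutions of the differential inclusions with
`x_R - x_L ≥ δ > 0` on `[t₀, T]`, then for each `C ∈ (C_R, C_L)` there is `λ > 0`,
independent of `δ`, such that the relative entropy of `U` with respect to `C` between the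
curves decreases at least by `λ |S_{a,b}|`, where `S_{a,b} = {s ∈ [a,b] : ẋ_R(s) ≥ ẋ_L(s)}`. -/
theorem inner_entropy_decay
    (A : ℝ → ℝ) (hA : ContDiff ℝ (⊤ : ℕ∞) A) (hA'' : ∀ x, 0 < deriv (deriv A) x)
    (U Um Up : ℝ → ℝ → ℝ)
    (hsol : IsEntropySol A U) (hlim : HasSideLimits U Um Up) (hcont : L1locCont U)
    (η : ℝ → ℝ) (hη : ContDiff ℝ (⊤ : ℕ∞) η) (hconv : ∀ v, 0 < deriv (deriv η) v)
    (CL CR : ℝ) (hLR : CR < CL)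
    (t₀ T : ℝ) (ht₀ : 0 ≤ t₀) (hT : t₀ < T) :
    ∀ C ∈ Ioo CR CL, ∃ lam : ℝ, 0 < lam ∧
      ∀ δ : ℝ, 0 < δ →
      ∀ xL xR dxL dxR : ℝ → ℝ, ∀ KL KR : NNReal,
        LipschitzOnWith KL xL (Icc t₀ T) → LipschitzOnWith KR xR (Icc t₀ T) →
        (∀ᵐ t ∂(volume.restrict (Icc t₀ T)), HasDerivAt xL (dxL t) t ∧
          normFlux A η (Up (xL t) t) CL ≤ dxL t ∧ dxL t ≤ normFlux A η (Um (xL t) t) CL) →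
        (∀ᵐ t ∂(volume.restrict (Icc t₀ T)), HasDerivAt xR (dxR t) t ∧
          normFlux A η (Up (xR t) t) CR ≤ dxR t ∧ dxR t ≤ normFlux A η (Um (xR t) t) CR) →
        (∀ t ∈ Icc t₀ T, δ ≤ xR t - xL t) →
        ∀ a b : ℝ, t₀ ≤ a → a < b → b ≤ T →
          (∫ x in xL b..xR b, relEnt η (U x b) C) - (∫ x in xL a..xR a, relEnt η (U x a) C)
            ≤ -(volume {s ∈ Icc a b | dxL s ≤ dxR s}).toReal * lam ∧
          -(volume {s ∈ Icc a b | dxL s ≤ dxR s}).toReal * lam ≤ 0 := by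
  intro C hC
  obtain ⟨M, hM⟩ := hsol.bounded
  obtain ⟨lam, hlam, hdis⟩ := exists_dissipation_lower_bound hA hA'' hη hconv hC M
  refine ⟨lam, hlam, ?_⟩
  intro δ hδ xL xR dxL dxR KL KR hxL hxR hdL hdR hgap a b hta hab hbT
  set S : Set ℝ := {s ∈ Icc a b | dxL s ≤ dxR s} with hS
  have hIcc : Icc a b ⊆ Icc t₀ T := Icc_subset_Icc hta hbT
  have hd1 : ∀ v, deriv (fun v => relEnt η v C) v = deriv η v - deriv η C := fun v =>
    (hasDerivAt_relEnt hη v C).deriv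
  obtain ⟨hPi, hP⟩ := hsol.entropy_balance_curves hlim hcont (contDiff_relEnt hη C)
    (contDiff_relFlux hA hη C)
    (fun v => by
      rw [funext hd1, deriv_sub_const]
      exact (hconv v).le)
    (fun v => by rw [hd1, (hasDerivAt_relFlux hA hη v C).deriv])
    (ht₀.trans hta) hab (hxL.mono hIcc) (hxR.mono hIcc)
    (fun t ht => by linarith [hgap t (hIcc ht)])
  have hdL' := ae_restrict_of_ae_restrict_of_subset hIcc hdL
  have hdR' := ae_restrict_of_ae_restrict_of_subset hIcc hdR
  let S' : Set ℝ := {s | deriv xL s ≤ deriv xR s}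
  have hS' : MeasurableSet S' := measurableSet_le (measurable_deriv xL) (measurable_deriv xR)
  have hvol : volume S = volume (S' ∩ Icc a b) := by
    refine measure_congr ?_
    have h1 := (ae_restrict_iff' measurableSet_Icc).1 hdL'
    have h2 := (ae_restrict_iff' measurableSet_Icc).1 hdR'
    filter_upwards [h1, h2] with t h1 h2
    refine propext ⟨fun h => ?_, fun h => ?_⟩
    · refine ⟨?_, h.1⟩
      change deriv xL t ≤ deriv xR t
      rw [(h1 h.1).1.deriv, (h2 h.1).1.deriv]; exact h.2
    · refine ⟨h.2, ?_⟩
      have h3 : deriv xL t ≤ deriv xR t := h.1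
      rwa [(h1 h.2).1.deriv, (h2 h.2).1.deriv] at h3
  have hUp : ∀ x t, 0 < t → |Up x t| ≤ M := fun x t ht =>
    le_of_tendsto (hlim.right x t ht).abs (Eventually.of_forall fun y => hM y t)
  have hUm : ∀ x t, 0 < t → |Um x t| ≤ M := fun x t ht =>
    le_of_tendsto (hlim.left x t ht).abs (Eventually.of_forall fun y => hM y t)
  have hpos : ∀ᵐ t ∂(volume.restrict (Icc a b)), 0 < t := by
    rw [← restrict_Ioo_eq_restrict_Icc]
    exact (ae_restrict_iff' measurableSet_Ioo).2
      (Eventually.of_forall fun t ht => (ht₀.trans hta).trans_lt ht.1)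
  refine ⟨hP.trans ?_, ?_⟩
  · have hind : ∫ t in Icc a b, S'.indicator (fun _ => -lam) t
        = -(volume S).toReal * lam := by
      rw [integral_indicator hS', Measure.restrict_restrict hS', setIntegral_const, hvol,
        smul_eq_mul, Measure.real]
      ring
    rw [← hind]
    refine integral_mono_ae hPi ((integrable_const _).indicator hS') ?_
    filter_upwards [hdL', hdR', hpos] with t hl hr ht
    obtain ⟨h1, h2⟩ := hdis (Up (xL t) t) (Um (xR t) t) (dxL t) (dxR t) (hUp _ _ ht) (hUm _ _ ht)
      hl.2.1 hr.2.2
    rw [hl.1.deriv, hr.1.deriv]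
    by_cases hs : t ∈ S'
    · rw [indicator_of_mem hs]
      have h3 : deriv xL t ≤ deriv xR t := hs
      rw [hl.1.deriv, hr.1.deriv] at h3
      exact h2 h3
    · rw [indicator_of_notMem hs]
      exact h1
  · exact mul_nonpos_of_nonpos_of_nonneg (neg_nonpos.2 ENNReal.toReal_nonneg) hlam.le
end
end
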